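/- For every N ≥ 2 there exists a constant D = D(N) ≥ 1 such that for every automorphism φ of F_N: (1/D)·log λ_A(φ) ≤ log λ_A(φ^{−1}) ≤ D·log λ_A(φ). -/

import Mathlib

/-- The reduced word length of an element of the free group on `Fin N`. -/
noncomputable def wlen {N : ℕ} (w : FreeGroup (Fin N)) : ℕ := w.toWord.length

/-- The cyclically reduced length of `w`: the minimal word length among all conjugates. -/
noncomputable def cyclen {N : ℕ} (w : FreeGroup (Fin N)) : ℕ :=
  sInf (Set.range fun g : FreeGroup (Fin N) => wlen (g * w * g⁻¹))

/-- The average of `‖φ w‖_A` over the sphere of radius `n`, divided by `n`. -/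
noncomputable def avg (N : ℕ) (φ : FreeGroup (Fin N) → FreeGroup (Fin N)) (n : ℕ) : ℝ :=
  (∑' w : {w : FreeGroup (Fin N) // wlen w = n}, (cyclen (φ w.1) : ℝ)) /
    ((n : ℝ) * ((2 * N * (2 * N - 1) ^ (n - 1) : ℕ) : ℝ))

/-- The generic stretching factor `λ_A(φ) = limsup_n avg_n(φ)`. -/
noncomputable def lamA (N : ℕ) (φ : FreeGroup (Fin N) → FreeGroup (Fin N)) : ℝ :=
  Filter.limsup (avg N φ) Filter.atTop

namespace GenericStretch

open FreeGroup hiding map_mul map_inv map_one map_pure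
open scoped ENNReal

variable {N : ℕ}

/-! ### Reduced words and word length -/

theorem isReduced_invRev {L : List (Fin N × Bool)} (h : IsReduced L) : IsReduced (invRev L) := by
  rw [isReduced_iff_reduce_eq, reduce_invRev, h.reduce_eq]

theorem toWord_mk_of_isReduced {L : List (Fin N × Bool)} (h : IsReduced L) :
    (mk L).toWord = L := by
  rw [toWord_mk, h.reduce_eq]

theorem wlen_mk {L : List (Fin N × Bool)} (h : IsReduced L) : wlen (mk L) = L.length := by
  rw [wlen, toWord_mk_of_isReduced h]

theorem wlen_mk_le (L : List (Fin N × Bool)) : wlen (mk L) ≤ L.length := norm_mk_le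

theorem wlen_mul_le (g h : FreeGroup (Fin N)) : wlen (g * h) ≤ wlen g + wlen h :=
  norm_mul_le g h

theorem wlen_inv (g : FreeGroup (Fin N)) : wlen g⁻¹ = wlen g := norm_inv_eq

theorem wlen_one : wlen (1 : FreeGroup (Fin N)) = 0 := norm_one

theorem wlen_pow_le (g : FreeGroup (Fin N)) (k : ℕ) : wlen (g ^ k) ≤ k * wlen g := by
  induction k with
  | zero => simp [wlen_one]
  | succ k ih =>
    rw [pow_succ]
    have := wlen_mul_le (g ^ k) g
    nlinarith

theorem wlen_map_mk_le (φ : FreeGroup (Fin N) →* FreeGroup (Fin N)) {K : ℕ}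
    (hK : ∀ i, wlen (φ (of i)) ≤ K) (L : List (Fin N × Bool)) :
    wlen (φ (mk L)) ≤ K * L.length := by
  induction L with
  | nil =>
    have : (mk [] : FreeGroup (Fin N)) = 1 := rfl
    simp [this, wlen_one]
  | cons b L ih =>
    have h1 : (mk (b :: L)) = mk [b] * mk L := by rw [mul_mk]; rfl
    have h2 : wlen (φ (mk [b])) ≤ K := by
      rcases b with ⟨i, b⟩
      cases b
      · have : (mk [(i, false)]) = (of i)⁻¹ := rfl
        rw [this, map_inv, wlen_inv]; exact hK i
      · exact hK i
    rw [h1, map_mul]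
    refine (wlen_mul_le _ _).trans ?_
    simp only [List.length_cons]
    nlinarith

theorem wlen_map_le (φ : FreeGroup (Fin N) →* FreeGroup (Fin N)) {K : ℕ}
    (hK : ∀ i, wlen (φ (of i)) ≤ K) (g : FreeGroup (Fin N)) :
    wlen (φ g) ≤ K * wlen g := by
  simpa [wlen, mk_toWord] using wlen_map_mk_le φ hK g.toWord

/-! ### Cyclically reduced length -/

theorem cyclen_le_conj (w g : FreeGroup (Fin N)) : cyclen w ≤ wlen (g * w * g⁻¹) :=
  Nat.sInf_le ⟨g, rfl⟩

theorem cyclen_le_wlen (w : FreeGroup (Fin N)) : cyclen w ≤ wlen w := by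
  simpa using cyclen_le_conj w 1

theorem exists_conj_eq_cyclen (w : FreeGroup (Fin N)) : ∃ g, wlen (g * w * g⁻¹) = cyclen w := by
  have := Nat.sInf_mem (Set.range_nonempty fun g : FreeGroup (Fin N) => wlen (g * w * g⁻¹))
  exact this

theorem cyclen_conj_le (w g : FreeGroup (Fin N)) : cyclen (g * w * g⁻¹) ≤ cyclen w := by
  obtain ⟨h, hh⟩ := exists_conj_eq_cyclen w
  rw [← hh]
  convert cyclen_le_conj (g * w * g⁻¹) (h * g⁻¹) using 2
  group

theorem cyclen_conj (w g : FreeGroup (Fin N)) : cyclen (g * w * g⁻¹) = cyclen w := by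
  refine le_antisymm (cyclen_conj_le w g) ?_
  have h : g⁻¹ * (g * w * g⁻¹) * g⁻¹⁻¹ = w := by group
  simpa only [h] using cyclen_conj_le (g * w * g⁻¹) g⁻¹

theorem exists_wlen_pow_le (w : FreeGroup (Fin N)) :
    ∃ C : ℕ, ∀ k : ℕ, wlen (w ^ k) ≤ k * cyclen w + C := by
  obtain ⟨g, hg⟩ := exists_conj_eq_cyclen w
  refine ⟨wlen g + wlen g, fun k => ?_⟩
  have h : w ^ k = g⁻¹ * (g * w * g⁻¹) ^ k * g := by
    rw [conj_pow]; group
  have h1 := wlen_mul_le (g⁻¹ * (g * w * g⁻¹) ^ k) g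
  have h2 := wlen_mul_le g⁻¹ ((g * w * g⁻¹) ^ k)
  have h3 := wlen_pow_le (g * w * g⁻¹) k
  rw [wlen_inv] at h2
  rw [hg] at h3
  rw [h]
  omega

open reduceCyclically in
theorem cyclen_le_length_reduceCyclically (w : FreeGroup (Fin N)) :
    cyclen w ≤ (reduceCyclically w.toWord).length := by
  have h := conj_conjugator_reduceCyclically w.toWord
  have h1 : w = mk (conjugator w.toWord) * mk (reduceCyclically w.toWord) *
      (mk (conjugator w.toWord))⁻¹ := by
    rw [inv_mk, mul_mk, mul_mk, h, mk_toWord]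
  rw [h1, cyclen_conj, ← h1]
  exact (cyclen_le_wlen _).trans (wlen_mk_le _)

theorem mul_cyclen_le_wlen_pow (w : FreeGroup (Fin N)) (k : ℕ) :
    k * cyclen w ≤ wlen (w ^ k) := by
  cases k with
  | zero => simp
  | succ k =>
    have h := cyclen_le_length_reduceCyclically w
    rw [wlen, toWord_pow, reduceCyclically.reduce_flatten_replicate_succ isReduced_toWord]
    simp only [List.length_append, List.length_flatten, List.map_replicate, List.sum_replicate,
      smul_eq_mul]
    nlinarith

theorem cyclen_map_le_of_wlen_map_le (φ : FreeGroup (Fin N) →* FreeGroup (Fin N)) {K : ℝ}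
    (h : ∀ g, (cyclen (φ g) : ℝ) ≤ K * wlen g) (g : FreeGroup (Fin N)) :
    (cyclen (φ g) : ℝ) ≤ K * cyclen g := by
  obtain ⟨k, hk⟩ := exists_conj_eq_cyclen g
  have h1 := h (k * g * k⁻¹)
  rwa [hk, map_mul, map_mul, map_inv, cyclen_conj] at h1

/-! ### Counting reduced words -/

/-- All words of length `k`. -/
def words (N k : ℕ) : Finset (List (Fin N × Bool)) :=
  (Finset.univ : Finset (Fin k → Fin N × Bool)).map ⟨List.ofFn, List.ofFn_injective⟩

theorem mem_words {k : ℕ} {L : List (Fin N × Bool)} : L ∈ words N k ↔ L.length = k := by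
  refine ⟨fun h => ?_, fun h => Finset.mem_map.2 ?_⟩
  · obtain ⟨v, _, rfl⟩ := Finset.mem_map.1 h
    simp
  · subst h
    exact ⟨L.get, Finset.mem_univ _, List.ofFn_get L⟩

open Classical in
/-- The sphere of radius `k`: reduced words of length `k`. -/
noncomputable def sphere (N k : ℕ) : Finset (List (Fin N × Bool)) :=
  (words N k).filter IsReduced

theorem mem_sphere {k : ℕ} {L : List (Fin N × Bool)} :
    L ∈ sphere N k ↔ L.length = k ∧ IsReduced L := by
  simp [sphere, mem_words]

open Classical in
/-- The words of length `k` that extend `s` to a reduced word. -/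
noncomputable def extensions (s : List (Fin N × Bool)) (k : ℕ) : Finset (List (Fin N × Bool)) :=
  (words N k).filter fun r => IsReduced (s ++ r)

theorem mem_extensions {s : List (Fin N × Bool)} {k : ℕ} {r : List (Fin N × Bool)} :
    r ∈ extensions s k ↔ r.length = k ∧ IsReduced (s ++ r) := by
  simp [extensions, mem_words]

theorem card_compatible (a : Fin N × Bool) :
    (Finset.univ.filter fun b : Fin N × Bool => a.1 = b.1 → a.2 = b.2).card = 2 * N - 1 := by
  have h : (Finset.univ.filter fun b : Fin N × Bool => a.1 = b.1 → a.2 = b.2) =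
      Finset.univ.erase (a.1, !a.2) := by
    ext ⟨i, b⟩
    rcases a with ⟨j, c⟩
    simp only [Finset.mem_filter, Finset.mem_univ, true_and, Finset.mem_erase, ne_eq,
      Prod.mk.injEq, and_true]
    by_cases h : j = i
    · subst h; cases b <;> cases c <;> simp
    · simp [h, Ne.symm h]
  rw [h, Finset.card_erase_of_mem (Finset.mem_univ _)]
  simp [mul_comm]

theorem card_extensions_singleton (a : Fin N × Bool) (k : ℕ) :
    (extensions [a] k).card = (2 * N - 1) ^ k := by
  induction k generalizing a with
  | zero =>
    rw [pow_zero, Finset.card_eq_one]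
    refine ⟨[], ?_⟩
    ext r
    simp only [mem_extensions, List.length_eq_zero_iff, Finset.mem_singleton]
    exact ⟨fun h => h.1, fun h => ⟨h, by subst h; simp⟩⟩
  | succ k ih =>
    have h : extensions [a] (k + 1) =
        (Finset.univ.filter fun b : Fin N × Bool => a.1 = b.1 → a.2 = b.2).biUnion
          fun b => (extensions [b] k).map ⟨List.cons b, List.cons_injective⟩ := by
      ext r
      simp only [mem_extensions, Finset.mem_biUnion, Finset.mem_filter, Finset.mem_univ, true_and,
        Finset.mem_map, Function.Embedding.coeFn_mk]
      constructor
      · rintro ⟨h1, h2⟩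
        cases r with
        | nil => simp at h1
        | cons b r =>
          rw [List.singleton_append, isReduced_cons_cons] at h2
          exact ⟨b, h2.1, r, ⟨by simpa using h1, h2.2⟩, rfl⟩
      · rintro ⟨b, hb, r, ⟨h1, h2⟩, rfl⟩
        refine ⟨by simp [h1], ?_⟩
        rw [List.singleton_append, isReduced_cons_cons]
        exact ⟨hb, h2⟩
    rw [h, Finset.card_biUnion]
    · simp [ih, card_compatible, pow_succ, mul_comm]
    · intro b _ c _ hbc
      rw [Function.onFun, Finset.disjoint_left]
      simp only [Finset.mem_map, Function.Embedding.coeFn_mk]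
      rintro x ⟨r, _, rfl⟩ ⟨r', _, h⟩
      exact hbc (List.cons.inj h).1.symm

theorem card_extensions {s : List (Fin N × Bool)} (hs : IsReduced s) (hne : s ≠ []) (k : ℕ) :
    (extensions s k).card = (2 * N - 1) ^ k := by
  obtain ⟨t, a, rfl⟩ := List.eq_nil_or_concat'  s |>.resolve_left hne
  rw [← card_extensions_singleton a k]
  congr 1
  ext r
  simp only [mem_extensions]
  refine and_congr_right fun _ => ⟨fun h => h.infix ⟨t, [], by simp⟩, fun h => ?_⟩
  exact hs.append_overlap h (by simp)

theorem card_prefixes {s : List (Fin N × Bool)} (hs : IsReduced s) (hne : s ≠ []) (k : ℕ) :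
    ((extensions (invRev s) k).map ⟨invRev, invRev_injective⟩).card = (2 * N - 1) ^ k := by
  rw [Finset.card_map, card_extensions (isReduced_invRev hs)]
  intro h
  apply hne
  simpa using congrArg invRev h

theorem card_sphere_succ (k : ℕ) : (sphere N (k + 1)).card = 2 * N * (2 * N - 1) ^ k := by
  have h : sphere N (k + 1) = (Finset.univ : Finset (Fin N × Bool)).biUnion
      fun b => (extensions [b] k).map ⟨List.cons b, List.cons_injective⟩ := by
    ext r
    simp only [mem_sphere, mem_extensions, Finset.mem_biUnion, Finset.mem_univ, true_and,
      Finset.mem_map, Function.Embedding.coeFn_mk]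
    constructor
    · rintro ⟨h1, h2⟩
      cases r with
      | nil => simp at h1
      | cons b r => exact ⟨b, r, ⟨by simpa using h1, h2⟩, rfl⟩
    · rintro ⟨b, r, ⟨h1, h2⟩, rfl⟩
      exact ⟨by simp [h1], h2⟩
  rw [h, Finset.card_biUnion]
  · simp [card_extensions_singleton, mul_comm]
  · intro b _ c _ hbc
    rw [Function.onFun, Finset.disjoint_left]
    simp only [Finset.mem_map, Function.Embedding.coeFn_mk]
    rintro x ⟨r, _, rfl⟩ ⟨r', _, h⟩
    exact hbc (List.cons.inj h).1.symm

theorem card_sphere {k : ℕ} (hk : 1 ≤ k) : (sphere N k).card = 2 * N * (2 * N - 1) ^ (k - 1) := by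
  obtain ⟨k, rfl⟩ := Nat.exists_eq_add_of_le' hk
  simp [card_sphere_succ]

theorem tsum_sphere (f : FreeGroup (Fin N) → ℝ) (n : ℕ) :
    ∑' w : {w : FreeGroup (Fin N) // wlen w = n}, f w.1 = ∑ L ∈ sphere N n, f (mk L) := by
  let e : {w : FreeGroup (Fin N) // wlen w = n} ≃ sphere N n :=
    { toFun := fun w => ⟨w.1.toWord, mem_sphere.2 ⟨w.2, isReduced_toWord⟩⟩
      invFun := fun L => ⟨mk L.1, by
        rw [wlen_mk (mem_sphere.1 L.2).2]; exact (mem_sphere.1 L.2).1⟩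
      left_inv := fun w => Subtype.ext mk_toWord
      right_inv := fun L => Subtype.ext (toWord_mk_of_isReduced (mem_sphere.1 L.2).2) }
  rw [← e.symm.tsum_eq, tsum_fintype, ← Finset.sum_coe_sort (sphere N n)]
  rfl

theorem avg_eq {n : ℕ} (hn : 1 ≤ n) (φ : FreeGroup (Fin N) → FreeGroup (Fin N)) :
    avg N φ n = (∑ L ∈ sphere N n, (cyclen (φ (mk L)) : ℝ)) / (n * (sphere N n).card) := by
  rw [avg, tsum_sphere (fun w => (cyclen (φ w) : ℝ)), card_sphere hn]

/-! ### Occurrences of subwords -/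

/-- The positions at which `s` occurs in `w`. -/
def positions (s w : List (Fin N × Bool)) : Finset ℕ :=
  (Finset.range (w.length + 1)).filter fun i => s <+: w.drop i

/-- The number of occurrences of `s` as a subword of `w`. -/
def occ (s w : List (Fin N × Bool)) : ℕ := (positions s w).card

theorem mem_positions {s w : List (Fin N × Bool)} {i : ℕ} :
    i ∈ positions s w ↔ i ≤ w.length ∧ s <+: w.drop i := by
  simp [positions]

theorem length_add_le_of_mem_positions {s w : List (Fin N × Bool)} {i : ℕ}
    (h : i ∈ positions s w) : s.length + i ≤ w.length := by
  obtain ⟨h1, h2⟩ := mem_positions.1 h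
  have := h2.length_le
  rw [List.length_drop] at this
  omega

theorem occ_cons_le (s w : List (Fin N × Bool)) (b : Fin N × Bool) :
    occ s (b :: w) ≤ occ s w + 1 := by
  have h : positions s (b :: w) ⊆ insert 0 ((positions s w).map ⟨Nat.succ, Nat.succ_injective⟩) := by
    intro i hi
    cases i with
    | zero => simp
    | succ i =>
      rw [Finset.mem_insert, Finset.mem_map]
      right
      refine ⟨i, ?_, rfl⟩
      rw [mem_positions] at hi ⊢
      simpa using hi
  refine (Finset.card_le_card h).trans ((Finset.card_insert_le _ _).trans ?_)
  rw [Finset.card_map]; rfl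

theorem occ_concat_le {s : List (Fin N × Bool)} (hs : s ≠ []) (w : List (Fin N × Bool))
    (b : Fin N × Bool) : occ s (w ++ [b]) ≤ occ s w + 1 := by
  have hpos := List.length_pos_iff.2 hs
  have h : positions s (w ++ [b]) ⊆ insert (w.length + 1 - s.length) (positions s w) := by
    intro i hi
    have h1 := length_add_le_of_mem_positions hi
    obtain ⟨_, h2⟩ := mem_positions.1 hi
    rw [List.length_append, List.length_singleton] at h1
    rw [Finset.mem_insert]
    by_cases hl : s.length + i = w.length + 1
    · left; omega
    · right
      rw [mem_positions]
      refine ⟨by omega, ?_⟩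
      rw [List.drop_append_of_le_length (by omega)] at h2
      exact List.prefix_of_prefix_length_le h2 (List.prefix_append _ _)
        (by rw [List.length_drop]; omega)
  exact (Finset.card_le_card h).trans (Finset.card_insert_le _ _)

theorem occ_append_le_left (s w c : List (Fin N × Bool)) : occ s (c ++ w) ≤ occ s w + c.length := by
  induction c with
  | nil => simp
  | cons b c ih =>
    have := occ_cons_le s (c ++ w) b
    simp only [List.cons_append, List.length_cons]
    omega

theorem occ_append_le_right {s : List (Fin N × Bool)} (hs : s ≠ []) (w c : List (Fin N × Bool)) :
    occ s (w ++ c) ≤ occ s w + c.length := by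
  induction c using List.reverseRecOn with
  | nil => simp
  | append_singleton c b ih =>
    have := occ_concat_le hs (w ++ c) b
    rw [← List.append_assoc, List.length_append, List.length_singleton]
    omega

theorem occ_append_ge {s : List (Fin N × Bool)} (hs : s ≠ []) (v w : List (Fin N × Bool)) :
    occ s v + occ s w ≤ occ s (v ++ w) := by
  have hpos := List.length_pos_iff.2 hs
  have hd : Disjoint (positions s v) ((positions s w).map (addLeftEmbedding v.length)) := by
    rw [Finset.disjoint_left]
    intro i hi hi'
    have := length_add_le_of_mem_positions hi
    simp only [Finset.mem_map, addLeftEmbedding_apply] at hi'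
    omega
  have h : positions s v ∪ ((positions s w).map (addLeftEmbedding v.length)) ⊆
      positions s (v ++ w) := by
    intro i hi
    rcases Finset.mem_union.1 hi with hi | hi
    · obtain ⟨h1, h2⟩ := mem_positions.1 hi
      rw [mem_positions, List.drop_append_of_le_length h1]
      exact ⟨by simp; omega, h2.trans (List.prefix_append _ _)⟩
    · simp only [Finset.mem_map, addLeftEmbedding_apply] at hi
      obtain ⟨j, hj, rfl⟩ := hi
      obtain ⟨h1, h2⟩ := mem_positions.1 hj
      rw [mem_positions]
      refine ⟨by simp [h1], ?_⟩
      rwa [List.drop_append, List.drop_eq_nil_of_le (by omega), List.nil_append,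
        Nat.add_sub_cancel_left]
  calc occ s v + occ s w = (positions s v ∪
        ((positions s w).map (addLeftEmbedding v.length))).card := by
        rw [Finset.card_union_of_disjoint hd, Finset.card_map]; rfl
    _ ≤ occ s (v ++ w) := Finset.card_le_card h

theorem mul_occ_le_occ_replicate {s : List (Fin N × Bool)} (hs : s ≠ [])
    (w : List (Fin N × Bool)) (k : ℕ) : k * occ s w ≤ occ s (List.replicate k w).flatten := by
  induction k with
  | zero => simp
  | succ k ih =>
    have := occ_append_ge hs w (List.replicate k w).flatten
    rw [List.replicate_succ, List.flatten_cons]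
    nlinarith

theorem sum_occ_ge {s : List (Fin N × Bool)} (hs : IsReduced s) (hne : s ≠ []) {n : ℕ}
    (hn : s.length ≤ n) :
    (n - s.length + 1) * (2 * N - 1) ^ (n - s.length) ≤ ∑ w ∈ sphere N n, occ s w := by
  have key : ∀ i ∈ Finset.range (n - s.length + 1), (2 * N - 1) ^ (n - s.length) ≤
      ((sphere N n).filter fun w => i ∈ positions s w).card := by
    intro i hi
    rw [Finset.mem_range] at hi
    set P := (extensions (invRev s) i).map ⟨invRev, invRev_injective⟩ with hP
    have hcard : (P ×ˢ extensions s (n - s.length - i)).card = (2 * N - 1) ^ (n - s.length) := by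
      rw [Finset.card_product, card_prefixes hs hne, card_extensions hs hne, ← pow_add]
      congr 1; omega
    have hPmem : ∀ p ∈ P, p.length = i ∧ IsReduced (p ++ s) := by
      intro p hp
      rw [hP, Finset.mem_map] at hp
      obtain ⟨p', hp', rfl⟩ := hp
      rw [mem_extensions] at hp'
      refine ⟨by simp [hp'.1], ?_⟩
      have := isReduced_invRev hp'.2
      simpa using this
    rw [← hcard]
    refine Finset.card_le_card_of_injOn (fun x => x.1 ++ s ++ x.2) ?_ ?_
    · rintro ⟨p, r⟩ hx
      rw [Finset.mem_coe, Finset.mem_product] at hx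
      obtain ⟨h1, h2⟩ := hPmem p hx.1
      obtain ⟨h3, h4⟩ := mem_extensions.1 hx.2
      dsimp only at h3
      simp only [Finset.coe_filter, Set.mem_ofPred_eq, mem_sphere, mem_positions]
      refine ⟨⟨by simp; omega, h2.append_overlap h4 hne⟩, by simp; omega, ?_⟩
      rw [List.append_assoc, ← h1, List.drop_left]
      exact List.prefix_append _ _
    · rintro ⟨p, r⟩ hx ⟨p', r'⟩ hx' heq
      rw [Finset.mem_coe, Finset.mem_product] at hx hx'
      simp only [List.append_assoc] at heq
      obtain ⟨h5, h6⟩ := List.append_inj heq ((hPmem p hx.1).1.trans (hPmem p' hx'.1).1.symm)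
      simp only [List.append_cancel_left_eq] at h6
      rw [h5, h6]
  calc (n - s.length + 1) * (2 * N - 1) ^ (n - s.length)
      = ∑ i ∈ Finset.range (n - s.length + 1), (2 * N - 1) ^ (n - s.length) := by simp
    _ ≤ ∑ i ∈ Finset.range (n - s.length + 1),
        ((sphere N n).filter fun w => i ∈ positions s w).card := Finset.sum_le_sum key
    _ = ∑ w ∈ sphere N n, ((Finset.range (n - s.length + 1)).filter
        fun i => i ∈ positions s w).card := by
        simp only [Finset.card_filter]
        exact Finset.sum_comm
    _ ≤ ∑ w ∈ sphere N n, occ s w := by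
        refine Finset.sum_le_sum fun w _ => Finset.card_le_card ?_
        intro i hi
        exact (Finset.mem_filter.1 hi).2

/-! ### The average conjugator length -/

open reduceCyclically in
theorem drop_eq_invRev_take {w : List (Fin N × Bool)} {r : ℕ} (hr : r ≤ (conjugator w).length) :
    2 * r ≤ w.length ∧ w.drop (w.length - r) = invRev (w.take r) := by
  have hw := conj_conjugator_reduceCyclically w
  set c := conjugator w
  set v := reduceCyclically w
  obtain ⟨c₁, c₂, hc, hl⟩ : ∃ c₁ c₂, c = c₁ ++ c₂ ∧ c₁.length = r :=
    ⟨c.take r, c.drop r, by simp, by simp [hr]⟩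
  have hw' : w = c₁ ++ (c₂ ++ v ++ invRev c₂) ++ invRev c₁ := by
    rw [← hw, hc, invRev_append]; simp
  have hlen : w.length = (c₁ ++ (c₂ ++ v ++ invRev c₂)).length + r := by
    conv_lhs => rw [hw']
    rw [List.length_append, invRev_length, hl]
  refine ⟨by rw [hlen]; simp; omega, ?_⟩
  rw [hlen, Nat.add_sub_cancel]
  conv_lhs => rw [hw']
  rw [List.drop_left, hw', List.append_assoc, ← hl, List.take_left]

open reduceCyclically in
theorem card_conjugator_ge_mul_le (n r : ℕ) (hr : 1 ≤ r) :
    ((sphere N n).filter fun w => r ≤ (conjugator w).length).card * (2 * N - 1) ^ r ≤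
      (sphere N n).card := by
  by_cases hn : 2 * r ≤ n
  · have h1 : ((sphere N n).filter fun w => r ≤ (conjugator w).length).card ≤
        (sphere N (n - r)).card := by
      refine Finset.card_le_card_of_injOn (fun w => w.take (n - r)) ?_ ?_
      · intro w hw
        simp only [Finset.coe_filter, Set.mem_ofPred_eq, mem_sphere] at hw
        rw [Finset.mem_coe, mem_sphere]
        exact ⟨by simp [hw.1.1], hw.1.2.infix (List.take_prefix _ _).isInfix⟩
      · intro w hw w' hw' h
        simp only [Finset.coe_filter, Set.mem_ofPred_eq, mem_sphere] at hw hw' h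
        have h2 := (drop_eq_invRev_take hw.2).2
        have h2' := (drop_eq_invRev_take hw'.2).2
        rw [hw.1.1] at h2
        rw [hw'.1.1] at h2'
        have h3 : w.take r = w'.take r := by
          have := congrArg (List.take r) h
          simpa [List.take_take, show min r (n - r) = r by omega] using this
        rw [← List.take_append_drop (n - r) w, ← List.take_append_drop (n - r) w', h2, h2', h3, h]
    refine (Nat.mul_le_mul_right _ h1).trans ?_
    rw [card_sphere (by omega), card_sphere (by omega), mul_assoc, ← pow_add]
    apply le_of_eq
    congr 2; omega
  · have : ((sphere N n).filter fun w => r ≤ (conjugator w).length) = ∅ := by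
      rw [Finset.filter_eq_empty_iff]
      intro w hw h
      have := (drop_eq_invRev_take h).1
      rw [(mem_sphere.1 hw).1] at this
      omega
    simp [this]

open reduceCyclically in
theorem sum_conjugator_le (hN : 2 ≤ N) (n : ℕ) :
    ∑ w ∈ sphere N n, ((conjugator w).length : ℝ) ≤ (sphere N n).card := by
  have h1 : ∀ w ∈ sphere N n, ((conjugator w).length : ℝ) ≤
      ∑ r ∈ Finset.range n, if r + 1 ≤ (conjugator w).length then (1 : ℝ) else 0 := by
    intro w hw
    rw [Finset.sum_boole]
    norm_cast
    have hle := (drop_eq_invRev_take (le_refl (conjugator w).length)).1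
    rw [(mem_sphere.1 hw).1] at hle
    calc (conjugator w).length = (Finset.range (conjugator w).length).card := by simp
      _ ≤ _ := Finset.card_le_card fun r hr => by
        simp only [Finset.mem_range, Finset.mem_filter] at hr ⊢
        omega
  have h2 : ∀ r, (∑ w ∈ sphere N n, if r + 1 ≤ (conjugator w).length then (1 : ℝ) else 0) ≤
      (sphere N n).card * (1 / 2) ^ (r + 1) := by
    intro r
    rw [Finset.sum_boole]
    have h3 := card_conjugator_ge_mul_le (N := N) n (r + 1) (by omega)
    have h4 : (2 : ℝ) ^ (r + 1) ≤ ((2 * N - 1 : ℕ) : ℝ) ^ (r + 1) := by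
      apply pow_le_pow_left₀ (by norm_num)
      exact_mod_cast (show 2 ≤ 2 * N - 1 by omega)
    rw [one_div, inv_pow, ← div_eq_mul_inv, le_div_iff₀ (by positivity)]
    refine (mul_le_mul_of_nonneg_left h4 (by positivity)).trans ?_
    exact_mod_cast h3
  have h3 : ∑ r ∈ Finset.range n, (1 / 2 : ℝ) ^ (r + 1) ≤ 1 := by
    have : ∀ n : ℕ, ∑ r ∈ Finset.range n, (1 / 2 : ℝ) ^ (r + 1) = 1 - (1 / 2) ^ n := by
      intro n
      induction n with
      | zero => simp
      | succ n ih => rw [Finset.sum_range_succ, ih]; ring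
    rw [this]
    have : (0 : ℝ) ≤ (1 / 2) ^ n := by positivity
    linarith
  calc ∑ w ∈ sphere N n, ((conjugator w).length : ℝ)
      ≤ ∑ w ∈ sphere N n, ∑ r ∈ Finset.range n,
          if r + 1 ≤ (conjugator w).length then (1 : ℝ) else 0 := Finset.sum_le_sum h1
    _ = ∑ r ∈ Finset.range n, ∑ w ∈ sphere N n,
          if r + 1 ≤ (conjugator w).length then (1 : ℝ) else 0 := Finset.sum_comm
    _ ≤ ∑ r ∈ Finset.range n, ((sphere N n).card : ℝ) * (1 / 2) ^ (r + 1) :=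
        Finset.sum_le_sum fun r _ => h2 r
    _ ≤ (sphere N n).card := by
        rw [← Finset.mul_sum]
        exact mul_le_of_le_one_right (by positivity) h3

/-! ### Positive variation of functions on the free group -/

/-- The total positive variation of `u` along right multiplication by `g`. -/
noncomputable def posVar (g : FreeGroup (Fin N)) (u : FreeGroup (Fin N) → ℝ) : ℝ≥0∞ :=
  ∑' h, ENNReal.ofReal (u (h * g) - u h)

theorem posVar_one (u : FreeGroup (Fin N) → ℝ) : posVar 1 u = 0 := by simp [posVar]

theorem posVar_mul_le (g g' : FreeGroup (Fin N)) (u : FreeGroup (Fin N) → ℝ) :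
    posVar (g * g') u ≤ posVar g u + posVar g' u := by
  have h1 : posVar g' u = ∑' h, ENNReal.ofReal (u (h * g * g') - u (h * g)) :=
    ((Equiv.mulRight g).tsum_eq fun h => ENNReal.ofReal (u (h * g') - u h)).symm
  rw [h1, posVar, posVar, ← ENNReal.tsum_add]
  refine ENNReal.tsum_le_tsum fun h => ?_
  rw [add_comm, ← mul_assoc]
  refine le_trans (ENNReal.ofReal_le_ofReal (le_of_eq ?_)) ENNReal.ofReal_add_le
  ring

theorem posVar_mk_le (L : List (Fin N × Bool)) (u : FreeGroup (Fin N) → ℝ) :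
    posVar (mk L) u ≤ (L.map fun b => posVar (mk [b]) u).sum := by
  induction L with
  | nil => exact (posVar_one u).le
  | cons b L ih =>
    have h1 : (mk (b :: L)) = mk [b] * mk L := by rw [mul_mk]; rfl
    rw [h1, List.map_cons, List.sum_cons]
    exact (posVar_mul_le _ _ _).trans (by gcongr)

theorem posVar_pow_le (g : FreeGroup (Fin N)) (u : FreeGroup (Fin N) → ℝ) (k : ℕ) :
    posVar (g ^ k) u ≤ k * posVar g u := by
  induction k with
  | zero => simp [posVar_one]
  | succ k ih =>
    rw [pow_succ]
    refine (posVar_mul_le _ _ _).trans ?_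
    push_cast
    rw [add_mul, one_mul]
    gcongr

theorem posVar_map (φ : MulAut (FreeGroup (Fin N))) (g : FreeGroup (Fin N))
    (u : FreeGroup (Fin N) → ℝ) : posVar g (fun h => u (φ h)) = posVar (φ g) u := by
  rw [posVar, posVar, ← φ.toEquiv.tsum_eq fun h => ENNReal.ofReal (u (h * φ g) - u h)]
  simp

theorem posVar_translate (o g : FreeGroup (Fin N)) (u : FreeGroup (Fin N) → ℝ) :
    posVar g (fun h => u (o * h)) = posVar g u := by
  rw [posVar, posVar, ← (Equiv.mulLeft o).tsum_eq fun h => ENNReal.ofReal (u (h * g) - u h)]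
  simp [mul_assoc]

theorem posVar_neg (g : FreeGroup (Fin N)) (u : FreeGroup (Fin N) → ℝ) :
    posVar g (fun h => - u h) = posVar g⁻¹ u := by
  rw [posVar, posVar, ← (Equiv.mulRight g).tsum_eq fun h => ENNReal.ofReal (u (h * g⁻¹) - u h)]
  simp only [Equiv.coe_mulRight, mul_inv_cancel_right]
  refine tsum_congr fun h => ?_
  congr 1; ring

theorem posVar_const_add (g : FreeGroup (Fin N)) (c : ℝ) (u : FreeGroup (Fin N) → ℝ) :
    posVar g (fun h => c + u h) = posVar g u := by
  simp [posVar]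

theorem posVar_le_add (g : FreeGroup (Fin N)) (u u' : FreeGroup (Fin N) → ℝ) :
    posVar g u ≤ posVar g u' + 2 * ∑' h, ENNReal.ofReal |u h - u' h| := by
  have h1 : ∑' h, ENNReal.ofReal |u h - u' h| = ∑' h, ENNReal.ofReal |u (h * g) - u' (h * g)| :=
    ((Equiv.mulRight g).tsum_eq fun h => ENNReal.ofReal |u h - u' h|).symm
  rw [two_mul]
  conv_rhs => rw [h1]
  conv_rhs => rw [← h1]
  nth_rewrite 1 [h1]
  rw [posVar, posVar, ← ENNReal.tsum_add, ← ENNReal.tsum_add]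
  refine ENNReal.tsum_le_tsum fun h => ?_
  rw [← ENNReal.ofReal_add (abs_nonneg _) (abs_nonneg _)]
  refine le_trans (ENNReal.ofReal_le_ofReal ?_) ENNReal.ofReal_add_le
  have h2 := le_abs_self (u (h * g) - u' (h * g))
  have h3 := neg_abs_le (u h - u' h)
  linarith

/-! ### Half-trees -/

/-- The indicator function of the half-tree of elements whose reduced word starts with `y`. -/
noncomputable def halfTree (y : Fin N × Bool) (h : FreeGroup (Fin N)) : ℝ :=
  if h.toWord.head? = some y then 1 else 0

theorem halfTree_sub_le (y b : Fin N × Bool) (h : FreeGroup (Fin N)) :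
    halfTree y (h * mk [b]) - halfTree y h ≤ if h = 1 ∧ b = y then 1 else 0 := by
  by_cases h1 : h = 1
  · subst h1
    by_cases hb : b = y
    · simp [halfTree, hb, toWord_mk]
    · simp [halfTree, hb, toWord_mk]
  · rw [if_neg (fun h' => h1 h'.1)]
    suffices (h * mk [b]).toWord.head? = some y → h.toWord.head? = some y by
      unfold halfTree
      split_ifs <;> simp_all
    intro h2
    have hr : IsReduced h.toWord := isReduced_toWord
    have hne : h.toWord ≠ [] := fun h' => h1 (toWord_eq_nil_iff.1 h')
    obtain ⟨t, a, hta⟩ := List.eq_nil_or_concat' h.toWord |>.resolve_left hne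
    by_cases hab : a.1 = b.1 → a.2 = b.2
    · have hr2 : IsReduced (t ++ [a] ++ [b]) := by
        rw [hta] at hr
        exact hr.append_overlap (by simpa [isReduced_cons_cons] using hab) (by simp)
      have : (h * mk [b]).toWord = t ++ [a] ++ [b] := by
        rw [← mk_toWord (x := h), hta, mul_mk, toWord_mk_of_isReduced hr2]
      rw [this, List.head?_append] at h2
      rw [hta]
      cases t <;> simpa using h2
    · have : h * mk [b] = mk t := by
        rw [← mk_toWord (x := h), hta, ← mul_mk, mul_assoc]
        have : mk [a] * mk [b] = 1 := by
          push Not at hab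
          have hb : mk [b] = (mk [a])⁻¹ := by
            rw [inv_mk]
            congr 1
            rcases a with ⟨i, a⟩; rcases b with ⟨j, b⟩
            obtain ⟨h3, h4⟩ := hab
            dsimp only at h3 h4
            subst h3
            cases a <;> cases b <;> simp_all [invRev]
          rw [hb, mul_inv_cancel]
        rw [this, mul_one]
      have ht : IsReduced t := hr.infix ⟨[], [a], by simp [hta]⟩
      rw [this, toWord_mk_of_isReduced ht] at h2
      rw [hta]
      cases t <;> simp_all

theorem posVar_halfTree_le (y b : Fin N × Bool) :
    posVar (mk [b]) (halfTree y) ≤ if b = y then 1 else 0 := by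
  refine (ENNReal.tsum_le_tsum fun h => ENNReal.ofReal_le_ofReal (halfTree_sub_le y b h)).trans ?_
  rw [tsum_eq_single 1]
  · split_ifs <;> simp_all
  · intro h hh
    simp [hh]

theorem posVar_mk_halfTree_le (y : Fin N × Bool) (L : List (Fin N × Bool)) :
    posVar (mk L) (halfTree y) ≤ L.count y := by
  refine (posVar_mk_le L _).trans ?_
  induction L with
  | nil => simp
  | cons b L ih =>
    rw [List.map_cons, List.sum_cons, List.count_cons, add_comm]
    push_cast
    refine add_le_add ih ((posVar_halfTree_le y b).trans ?_)
    simp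

theorem sum_count_eq_length (L : List (Fin N × Bool)) : ∑ y, L.count y = L.length := by
  induction L with
  | nil => simp
  | cons b L ih => simp [List.count_cons, Finset.sum_add_distrib, ih]

theorem sum_posVar_halfTree_le (g : FreeGroup (Fin N)) :
    ∑ y, posVar g (halfTree y) ≤ wlen g := by
  rw [wlen, ← sum_count_eq_length]
  push_cast
  refine Finset.sum_le_sum fun y _ => ?_
  conv_lhs => rw [← mk_toWord (x := g)]
  exact posVar_mk_halfTree_le y _

theorem wlen_le_sum_posVar_halfTree (g : FreeGroup (Fin N)) :
    (wlen g : ℝ≥0∞) ≤ ∑ y, posVar g (halfTree y) := by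
  simp only [posVar]
  rw [← Summable.tsum_finsetSum fun _ _ => ENNReal.summable]
  set F : FreeGroup (Fin N) → ℝ≥0∞ :=
    fun h => ∑ y, ENNReal.ofReal (halfTree y (h * g) - halfTree y h) with hF
  have hr : IsReduced g.toWord := isReduced_toWord
  let x : ℕ → FreeGroup (Fin N) := fun i => (mk (g.toWord.take i))⁻¹
  have hxw : ∀ i, (x i).toWord = invRev (g.toWord.take i) := fun i => by
    rw [toWord_inv, toWord_mk_of_isReduced (hr.infix (List.take_prefix _ _).isInfix)]
  have hinj : Set.InjOn x (Finset.range (wlen g)) := by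
    intro i hi j hj hij
    have h1 := congrArg (fun w => w.toWord.length) hij
    simp only [hxw, invRev_length, List.length_take] at h1
    simp only [Finset.coe_range, Set.mem_Iio, wlen] at hi hj
    omega
  have hF1 : ∀ i ∈ Finset.range (wlen g), 1 ≤ F (x i) := by
    intro i hi
    rw [Finset.mem_range] at hi
    have hi' : i < g.toWord.length := hi
    refine le_trans ?_ (Finset.single_le_sum (fun _ _ => zero_le)
      (Finset.mem_univ (g.toWord[i])))
    have h1 : x i * g = mk (g.toWord.drop i) := by
      rw [inv_mul_eq_iff_eq_mul, mul_mk, List.take_append_drop, mk_toWord]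
    have h2 : halfTree (g.toWord[i]) (x i * g) = 1 := by
      rw [h1, halfTree, toWord_mk_of_isReduced (hr.infix (List.drop_suffix _ _).isInfix),
        List.head?_drop, if_pos (List.getElem?_eq_getElem hi')]
    have h3 : halfTree (g.toWord[i]) (x i) = 0 := by
      rw [halfTree, hxw, if_neg]
      intro h4
      cases i with
      | zero => simp at h4
      | succ i =>
        rw [List.take_succ_eq_append_getElem (by omega), invRev_append] at h4
        simp only [invRev, List.map_cons, List.map_nil, List.reverse_singleton,
          List.singleton_append, List.head?_cons, Option.some.injEq] at h4
        have h5 := List.isChain_iff_getElem.1 hr i (by omega)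
        rw [← h4] at h5
        simp at h5
    rw [h2, h3]
    simp
  calc (wlen g : ℝ≥0∞) = ∑ i ∈ Finset.range (wlen g), 1 := by simp
    _ ≤ ∑ i ∈ Finset.range (wlen g), F (x i) := Finset.sum_le_sum hF1
    _ = ∑ h ∈ (Finset.range (wlen g)).image x, F h := (Finset.sum_image hinj).symm
    _ ≤ ∑' h, F h := ENNReal.sum_le_tsum _

/-! ### Upper bounds for translation lengths -/

theorem le_of_forall_mul_le_add {a b c : ℝ≥0∞} (hc : c ≠ ∞) (h : ∀ k : ℕ, k * a ≤ k * b + c) :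
    a ≤ b := by
  refine le_of_forall_pos_le_add fun ε hε => ?_
  by_cases hb : b = ∞
  · simp [hb]
  by_cases hε' : ε = ∞
  · simp [hε']
  obtain ⟨k, hk⟩ := ENNReal.exists_nat_mul_gt hε.ne' hc
  have hk0 : (k : ℝ≥0∞) ≠ 0 := by
    rintro h0
    simp [h0] at hk
  have h1 : (k : ℝ≥0∞) * a ≤ k * (b + ε) := by
    rw [mul_add]
    exact (h k).trans (by gcongr)
  exact (ENNReal.mul_le_mul_iff_right hk0 (by simp)).1 h1

theorem cyclen_le_sum_posVar (φ : MulAut (FreeGroup (Fin N)))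
    (u : Fin N × Bool → FreeGroup (Fin N) → ℝ)
    (hu : ∀ y, ∑' h, ENNReal.ofReal |halfTree y (φ h) - u y h| ≠ ∞) (L : List (Fin N × Bool)) :
    (cyclen (φ (mk L)) : ℝ≥0∞) ≤ ∑ y, (L.map fun b => posVar (mk [b]) (u y)).sum := by
  refine le_trans (b := ∑ y, posVar (mk L) (u y)) ?_ (Finset.sum_le_sum fun y _ => posVar_mk_le _ _)
  refine le_of_forall_mul_le_add
    (c := ∑ y, 2 * ∑' h, ENNReal.ofReal |halfTree y (φ h) - u y h|) ?_ fun k => ?_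
  · refine (ENNReal.sum_lt_top.2 fun y _ => ?_).ne
    exact ENNReal.mul_lt_top (by simp) (lt_top_iff_ne_top.2 (hu y))
  · calc (k : ℝ≥0∞) * cyclen (φ (mk L)) ≤ wlen (φ (mk L) ^ k) := by
          exact_mod_cast mul_cyclen_le_wlen_pow _ _
      _ ≤ ∑ y, posVar (φ (mk L) ^ k) (halfTree y) := wlen_le_sum_posVar_halfTree _
      _ = ∑ y, posVar (mk L ^ k) (fun h => halfTree y (φ h)) := by
          simp only [posVar_map, map_pow]
      _ ≤ ∑ y, (k * posVar (mk L) (u y) + 2 * ∑' h, ENNReal.ofReal |halfTree y (φ h) - u y h|) := by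
          refine Finset.sum_le_sum fun y _ => (posVar_le_add _ _ (u y)).trans ?_
          gcongr
          exact posVar_pow_le _ _ _
      _ = _ := by rw [Finset.sum_add_distrib, Finset.mul_sum]

/-! ### Bounds for averages -/

theorem avg_nonneg (φ : FreeGroup (Fin N) → FreeGroup (Fin N)) (n : ℕ) : 0 ≤ avg N φ n := by
  unfold avg
  exact div_nonneg (tsum_nonneg fun _ => by positivity) (by positivity)

theorem card_sphere_pos (hN : 2 ≤ N) (n : ℕ) : 0 < (sphere N n).card := by
  cases n with
  | zero => exact Finset.card_pos.2 ⟨[], mem_sphere.2 ⟨rfl, by simp⟩⟩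
  | succ n =>
    rw [card_sphere_succ]
    have : 0 < 2 * N - 1 := by omega
    positivity

theorem avg_le (hN : 2 ≤ N) {φ : FreeGroup (Fin N) → FreeGroup (Fin N)} {K : ℝ}
    (hK : ∀ g, (cyclen (φ g) : ℝ) ≤ K * wlen g) {n : ℕ} (hn : 1 ≤ n) : avg N φ n ≤ K := by
  rw [avg_eq hn, div_le_iff₀ (by have := card_sphere_pos hN n; positivity)]
  calc ∑ L ∈ sphere N n, (cyclen (φ (mk L)) : ℝ) ≤ ∑ L ∈ sphere N n, K * n := by
        refine Finset.sum_le_sum fun L hL => (hK _).trans (le_of_eq ?_)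
        rw [wlen_mk (mem_sphere.1 hL).2, (mem_sphere.1 hL).1]
    _ = K * (n * (sphere N n).card) := by
        rw [Finset.sum_const, nsmul_eq_mul]; ring

theorem lamA_le (hN : 2 ≤ N) {φ : FreeGroup (Fin N) → FreeGroup (Fin N)} {K : ℝ}
    (hK : ∀ g, (cyclen (φ g) : ℝ) ≤ K * wlen g) : lamA N φ ≤ K := by
  refine Filter.limsup_le_of_le
    (Filter.isBoundedUnder_of ⟨0, avg_nonneg φ⟩).isCoboundedUnder_le ?_
  filter_upwards [Filter.eventually_ge_atTop 1] with n hn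
  exact avg_le hN hK hn

theorem le_lamA (hN : 2 ≤ N) {φ : FreeGroup (Fin N) → FreeGroup (Fin N)} {K c C : ℝ}
    (hK : ∀ g, (cyclen (φ g) : ℝ) ≤ K * wlen g)
    (h : ∀ᶠ n : ℕ in Filter.atTop, c - C / n ≤ avg N φ n) : c ≤ lamA N φ := by
  have ht : Filter.Tendsto (fun n : ℕ => c - C / n) Filter.atTop (nhds c) := by
    simpa using tendsto_const_nhds.sub (tendsto_const_div_atTop_nhds_zero_nat C)
  rw [← ht.limsup_eq]
  refine Filter.limsup_le_limsup h ?_ ?_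
  · exact ht.isCoboundedUnder_le
  · refine ⟨K, ?_⟩
    rw [Filter.eventually_map]
    filter_upwards [Filter.eventually_ge_atTop 1] with n hn
    exact avg_le hN hK hn

theorem exists_wlen_map_le (φ : FreeGroup (Fin N) →* FreeGroup (Fin N)) :
    ∃ K : ℕ, ∀ g, wlen (φ g) ≤ K * wlen g :=
  ⟨∑ i, wlen (φ (of i)), wlen_map_le φ fun i =>
    Finset.single_le_sum (f := fun i => wlen (φ (of i))) (fun _ _ => Nat.zero_le _)
      (Finset.mem_univ i)⟩

theorem exists_cyclen_map_le (φ : MulAut (FreeGroup (Fin N))) :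
    ∃ K : ℝ, ∀ g, (cyclen (φ g) : ℝ) ≤ K * wlen g := by
  obtain ⟨K, hK⟩ := exists_wlen_map_le φ.toMonoidHom
  exact ⟨K, fun g => by exact_mod_cast (cyclen_le_wlen _).trans (hK g)⟩

/-! ### The word connecting two points of a sphere -/

/-- The length of the longest common prefix. -/
def commonPrefix : List (Fin N × Bool) → List (Fin N × Bool) → ℕ
  | a :: x, b :: z => if a = b then commonPrefix x z + 1 else 0
  | [], _ => 0
  | _ :: _, [] => 0

/-- The reduced word read off along the geodesic from `x` to `z`. -/
def connect (x z : List (Fin N × Bool)) : List (Fin N × Bool) :=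
  invRev (x.drop (commonPrefix x z)) ++ z.drop (commonPrefix x z)

theorem exists_eq_append_of_ne {x z : List (Fin N × Bool)} (hl : x.length = z.length)
    (hne : x ≠ z) : ∃ g a b x' z', x = g ++ a :: x' ∧ z = g ++ b :: z' ∧ a ≠ b ∧
      commonPrefix x z = g.length := by
  induction x generalizing z with
  | nil => exact absurd (List.length_eq_zero_iff.1 hl.symm).symm hne
  | cons a x ih =>
    cases z with
    | nil => simp at hl
    | cons b z =>
      by_cases hab : a = b
      · subst hab
        obtain ⟨g, a', b', x', z', h1, h2, h3, h4⟩ := ih (by simpa using hl) (by simpa using hne)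
        exact ⟨a :: g, a', b', x', z', by rw [h1]; rfl, by rw [h2]; rfl, h3,
          by simp [commonPrefix, h4]⟩
      · exact ⟨[], a, b, x, z, rfl, rfl, hab, by simp [commonPrefix, hab]⟩

theorem le_commonPrefix {v x z : List (Fin N × Bool)} (hx : v <+: x) (hz : v <+: z) :
    v.length ≤ commonPrefix x z := by
  obtain ⟨x, rfl⟩ := hx
  obtain ⟨z, rfl⟩ := hz
  induction v with
  | nil => simp
  | cons a v ih => simpa [commonPrefix] using ih

theorem commonPrefix_lt {x z : List (Fin N × Bool)} (hl : x.length = z.length) (hne : x ≠ z) :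
    commonPrefix x z < x.length := by
  obtain ⟨g, a, b, x', z', rfl, rfl, _, h⟩ := exists_eq_append_of_ne hl hne
  rw [h]; simp

theorem length_connect {x z : List (Fin N × Bool)} (hl : x.length = z.length) :
    (connect x z).length = 2 * (x.length - commonPrefix x z) := by
  simp [connect, hl]; omega

theorem isReduced_connect {x z : List (Fin N × Bool)} (hl : x.length = z.length) (hne : x ≠ z)
    (hx : IsReduced x) (hz : IsReduced z) : IsReduced (connect x z) := by
  obtain ⟨g, a, b, x', z', rfl, rfl, hab, h⟩ := exists_eq_append_of_ne hl hne
  rw [connect, h, List.drop_left, List.drop_left]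
  have h1 : IsReduced (invRev x' ++ invRev [a]) := by
    rw [← invRev_append]; exact isReduced_invRev (hx.infix ⟨g, [], by simp⟩)
  have h2 : IsReduced (b :: z') := hz.infix ⟨g, [], by simp⟩
  have h3 : IsReduced (invRev [a] ++ b :: z') := by
    simp only [invRev, List.map_cons, List.map_nil, List.reverse_singleton, List.singleton_append]
    rw [isReduced_cons_cons]
    refine ⟨fun h4 => ?_, h2⟩
    rcases a with ⟨i, a⟩; rcases b with ⟨j, b⟩
    simp only at h4 ⊢
    subst h4
    cases a <;> cases b <;> simp_all
  rw [invRev_cons]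
  exact h1.append_overlap h3 (by simp [invRev])

/-! ### Locally constant sets and their energy -/

/-- Membership of `h` in `U` depends only on the first `m` letters of `h`. -/
def LocConst (U : Set (FreeGroup (Fin N))) (m : ℕ) : Prop :=
  ∀ L : List (Fin N × Bool), IsReduced L → m ≤ L.length → (mk L ∈ U ↔ mk (L.take m) ∈ U)

theorem LocConst.mono {U : Set (FreeGroup (Fin N))} {m m' : ℕ} (h : LocConst U m) (hm : m ≤ m') :
    LocConst U m' := by
  intro L hL hl
  rw [h L hL (hm.trans hl), h (L.take m') (hL.infix (List.take_prefix _ _).isInfix)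
    (by simp [hm, hm.trans hl]), List.take_take, min_eq_left hm]

open Classical in
/-- The pairs of points of the `m`-sphere leading from outside `U` into `U`. -/
noncomputable def pairs (U : Set (FreeGroup (Fin N))) (m : ℕ) :
    Finset (List (Fin N × Bool) × List (Fin N × Bool)) :=
  (sphere N m ×ˢ sphere N m).filter fun p => mk p.1 ∉ U ∧ mk p.2 ∈ U

theorem mem_pairs {U : Set (FreeGroup (Fin N))} {m : ℕ}
    {p : List (Fin N × Bool) × List (Fin N × Bool)} :
    p ∈ pairs U m ↔ ((p.1.length = m ∧ IsReduced p.1) ∧ (p.2.length = m ∧ IsReduced p.2)) ∧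
      mk p.1 ∉ U ∧ mk p.2 ∈ U := by
  simp [pairs, mem_sphere]

theorem ne_of_mem_pairs {U : Set (FreeGroup (Fin N))} {m : ℕ}
    {p : List (Fin N × Bool) × List (Fin N × Bool)} (hp : p ∈ pairs U m) : p.1 ≠ p.2 := by
  intro h
  have := (mem_pairs.1 hp).2
  rw [h] at this
  exact this.1 this.2

/-- The energy of `U` at level `m`. -/
noncomputable def energy (U : Set (FreeGroup (Fin N))) (m : ℕ) : ℝ :=
  ∑ p ∈ pairs U m,
    ((2 * N - 1 : ℕ) : ℝ) ^ (2 * commonPrefix p.1 p.2 + 1) / ((2 * N - 1 : ℕ) : ℝ) ^ (2 * m)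

theorem connect_ne_nil {U : Set (FreeGroup (Fin N))} {m : ℕ}
    {p : List (Fin N × Bool) × List (Fin N × Bool)} (hp : p ∈ pairs U m) :
    connect p.1 p.2 ≠ [] := by
  have hp' := (mem_pairs.1 hp).1
  have hl : p.1.length = p.2.length := hp'.1.1.trans hp'.2.1.symm
  rw [← List.length_pos_iff, length_connect hl]
  have := commonPrefix_lt hl (ne_of_mem_pairs hp)
  omega

theorem exists_crossing {x z w : List (Fin N × Bool)} {m i : ℕ} (hx : x.length = m)
    (hz : z.length = m) (hxr : IsReduced x) (hzr : IsReduced z) (hne : x ≠ z) (hw : IsReduced w)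
    (hi : i ∈ positions (connect x z) w) :
    ∃ r, IsReduced (x ++ invRev (w.take i)) ∧ IsReduced (z ++ r) ∧
      mk (x ++ invRev (w.take i)) * mk w = mk (z ++ r) := by
  obtain ⟨hi1, r, hr⟩ := mem_positions.1 hi
  have hwe : w = w.take i ++ (connect x z ++ r) := by rw [hr, List.take_append_drop]
  set p := w.take i with hp
  clear_value p
  obtain ⟨g, a, b, x', z', h1, h2, -, h3⟩ := exists_eq_append_of_ne (hx.trans hz.symm) hne
  have hc : connect x z = invRev (a :: x') ++ b :: z' := by
    rw [connect, h3]
    conv_lhs => rw [h1, h2]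
    rw [List.drop_left, List.drop_left]
  rw [hc] at hwe
  refine ⟨r, ?_, ?_, ?_⟩
  · have h4 : IsReduced (a :: x' ++ invRev p) := by
      have : IsReduced (p ++ invRev (a :: x')) := hw.infix ⟨[], b :: z' ++ r, by simp [hwe]⟩
      simpa using isReduced_invRev this
    rw [h1] at hxr ⊢
    exact hxr.append_overlap h4 (by simp)
  · have h4 : IsReduced (b :: z' ++ r) := hw.infix ⟨p ++ invRev (a :: x'), [], by simp [hwe]⟩
    rw [h2] at hzr ⊢
    exact hzr.append_overlap h4 (by simp)
  · rw [hwe, h1, h2]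
    simp only [← mul_mk, ← inv_mk]
    group

theorem sum_occ_le_posVar {U : Set (FreeGroup (Fin N))} {m : ℕ} (hU : LocConst U m)
    {w : List (Fin N × Bool)} (hw : IsReduced w) :
    ((∑ p ∈ pairs U m, occ (connect p.1 p.2) w : ℕ) : ℝ≥0∞) ≤ posVar (mk w) (U.indicator 1) := by
  classical
  let T := (pairs U m).sigma fun p => positions (connect p.1 p.2) w
  let f : (Σ _ : List (Fin N × Bool) × List (Fin N × Bool), ℕ) → List (Fin N × Bool) :=
    fun t => t.1.1 ++ invRev (w.take t.2)
  have key : ∀ t ∈ T, IsReduced (f t) ∧ mk (f t) ∉ U ∧ mk (f t) * mk w ∈ U ∧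
      (f t).length = m + t.2 ∧ (f t).take m = t.1.1 ∧
      (mk (f t) * mk w).toWord.take m = t.1.2 := by
    rintro ⟨⟨x, z⟩, i⟩ ht
    simp only [T, Finset.mem_sigma] at ht
    have hne := ne_of_mem_pairs ht.1
    obtain ⟨⟨⟨hx, hxr⟩, hz, hzr⟩, hxU, hzU⟩ := mem_pairs.1 ht.1
    dsimp only at hx hxr hz hzr hxU hzU ht hne
    obtain ⟨r, h1, h2, h3⟩ := exists_crossing hx hz hxr hzr hne hw ht.2
    have hi := (mem_positions.1 ht.2).1
    simp only [f]
    refine ⟨h1, ?_, ?_, by simp [hx, hi], by rw [← hx, List.take_left], ?_⟩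
    · rwa [hU _ h1 (by simp [hx]), ← hx, List.take_left]
    · rwa [h3, hU _ h2 (by simp [hz]), ← hz, List.take_left]
    · rw [h3, toWord_mk_of_isReduced h2, ← hz, List.take_left]
  have hinj : Set.InjOn (fun t => mk (f t)) (T : Set _) := by
    intro t ht t' ht' heq
    obtain ⟨k1, -, -, k4, k5, k6⟩ := key t ht
    obtain ⟨k1', -, -, k4', k5', k6'⟩ := key t' ht'
    have h1 : f t = f t' := by
      have := congrArg toWord heq
      simpa only [toWord_mk_of_isReduced k1, toWord_mk_of_isReduced k1'] using this
    rw [← h1] at k4' k5' k6'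
    rcases t with ⟨⟨x, z⟩, i⟩
    rcases t' with ⟨⟨x', z'⟩, i'⟩
    dsimp only at k4 k5 k6 k4' k5' k6'
    obtain rfl : i = i' := by omega
    rw [← k5, ← k6, k5', k6']
  calc ((∑ p ∈ pairs U m, occ (connect p.1 p.2) w : ℕ) : ℝ≥0∞) = ∑ t ∈ T, 1 := by
        simp [T, occ, Finset.card_sigma]
    _ ≤ ∑ t ∈ T, ENNReal.ofReal (U.indicator 1 (mk (f t) * mk w) - U.indicator 1 (mk (f t))) := by
        refine Finset.sum_le_sum fun t ht => ?_
        obtain ⟨-, k2, k3, -⟩ := key t ht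
        rw [Set.indicator_of_mem k3, Set.indicator_of_notMem k2]
        simp
    _ = ∑ h ∈ T.image (fun t => mk (f t)),
          ENNReal.ofReal (U.indicator 1 (h * mk w) - U.indicator 1 h) :=
        (Finset.sum_image (f := fun h =>
          ENNReal.ofReal (U.indicator 1 (h * mk w) - U.indicator 1 h)) hinj).symm
    _ ≤ _ := ENNReal.sum_le_tsum _

/-! ### The lower bound for the stretching factor -/

/-- The translate of the `φ`-preimage of a half-tree. -/
def halfSet (φ : MulAut (FreeGroup (Fin N))) (o : FreeGroup (Fin N)) (y : Fin N × Bool) :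
    Set (FreeGroup (Fin N)) :=
  {h | (φ (o * h)).toWord.head? = some y}

theorem indicator_halfSet (φ : MulAut (FreeGroup (Fin N))) (o : FreeGroup (Fin N))
    (y : Fin N × Bool) :
    (halfSet φ o y).indicator 1 = fun h => halfTree y (φ (o * h)) := by
  ext h
  simp [halfSet, halfTree, Set.indicator_apply]

theorem posVar_indicator_halfSet (φ : MulAut (FreeGroup (Fin N))) (o g : FreeGroup (Fin N))
    (y : Fin N × Bool) :
    posVar g ((halfSet φ o y).indicator 1) = posVar (φ g) (halfTree y) := by
  rw [indicator_halfSet, posVar_translate o g fun h => halfTree y (φ h), posVar_map]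

theorem sum_occ_le_cyclen (φ : MulAut (FreeGroup (Fin N))) (o : Fin N × Bool → FreeGroup (Fin N))
    {m : ℕ} (hU : ∀ y, LocConst (halfSet φ (o y) y) m) {w : List (Fin N × Bool)}
    (hw : IsCyclicallyReduced w) :
    ∑ y, ∑ p ∈ pairs (halfSet φ (o y) y) m, occ (connect p.1 p.2) w ≤ cyclen (φ (mk w)) := by
  obtain ⟨C, hC⟩ := exists_wlen_pow_le (φ (mk w))
  suffices h : ((∑ y, ∑ p ∈ pairs (halfSet φ (o y) y) m, occ (connect p.1 p.2) w : ℕ) : ℝ≥0∞) ≤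
      (cyclen (φ (mk w)) : ℝ≥0∞) by exact_mod_cast h
  refine le_of_forall_mul_le_add (c := C) (by simp) fun k => ?_
  have hwk : mk w ^ k = mk (List.replicate k w).flatten := by
    induction k with
    | zero => rfl
    | succ k ih => rw [pow_succ', ih, mul_mk, List.replicate_succ, List.flatten_cons]
  calc (k : ℝ≥0∞) * ((∑ y, ∑ p ∈ pairs (halfSet φ (o y) y) m, occ (connect p.1 p.2) w : ℕ) : ℝ≥0∞)
      ≤ ∑ y, ((∑ p ∈ pairs (halfSet φ (o y) y) m,
          occ (connect p.1 p.2) (List.replicate k w).flatten : ℕ) : ℝ≥0∞) := by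
        rw [← Nat.cast_sum]
        norm_cast
        simp only [Finset.mul_sum]
        exact Finset.sum_le_sum fun y _ => Finset.sum_le_sum fun p hp =>
          mul_occ_le_occ_replicate (connect_ne_nil hp) w k
    _ ≤ ∑ y, posVar (mk w ^ k) ((halfSet φ (o y) y).indicator 1) := by
        rw [hwk]
        exact Finset.sum_le_sum fun y _ =>
          sum_occ_le_posVar (hU y) (hw.flatten_replicate k).isReduced
    _ = ∑ y, posVar (φ (mk w) ^ k) (halfTree y) := by
        simp only [posVar_indicator_halfSet, map_pow]
    _ ≤ wlen (φ (mk w) ^ k) := sum_posVar_halfTree_le _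
    _ ≤ k * cyclen (φ (mk w)) + C := by exact_mod_cast hC k

open reduceCyclically in
theorem sum_occ_le_cyclen_add (φ : MulAut (FreeGroup (Fin N)))
    (o : Fin N × Bool → FreeGroup (Fin N)) {m : ℕ} (hU : ∀ y, LocConst (halfSet φ (o y) y) m)
    {w : List (Fin N × Bool)} (hw : IsReduced w) :
    ∑ y, ∑ p ∈ pairs (halfSet φ (o y) y) m, occ (connect p.1 p.2) w ≤
      cyclen (φ (mk w)) +
        2 * (∑ y, (pairs (halfSet φ (o y) y) m).card) * (conjugator w).length := by
  have hwe := conj_conjugator_reduceCyclically w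
  have h1 := sum_occ_le_cyclen φ o hU (isCyclicallyReduced hw)
  set c := conjugator w
  set v := reduceCyclically w
  have h2 : cyclen (φ (mk w)) = cyclen (φ (mk v)) := by
    rw [← hwe, ← mul_mk, ← mul_mk, ← inv_mk, map_mul, map_mul, map_inv, cyclen_conj]
  rw [h2]
  refine le_trans ?_ (Nat.add_le_add_right h1 _)
  rw [Finset.mul_sum, Finset.sum_mul, ← Finset.sum_add_distrib]
  refine Finset.sum_le_sum fun y _ => ?_
  calc ∑ p ∈ pairs (halfSet φ (o y) y) m, occ (connect p.1 p.2) w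
      ≤ ∑ p ∈ pairs (halfSet φ (o y) y) m, (occ (connect p.1 p.2) v + 2 * c.length) := by
        refine Finset.sum_le_sum fun p hp => ?_
        have h3 := occ_append_le_right (connect_ne_nil hp) (c ++ v) (invRev c)
        have h4 := occ_append_le_left (connect p.1 p.2) v c
        rw [hwe, invRev_length] at h3
        omega
    _ = _ := by
        rw [Finset.sum_add_distrib, Finset.sum_const, smul_eq_mul]; ring

theorem sum_sum_occ_le (hN : 2 ≤ N) (φ : MulAut (FreeGroup (Fin N)))
    (o : Fin N × Bool → FreeGroup (Fin N)) {m : ℕ} (hU : ∀ y, LocConst (halfSet φ (o y) y) m)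
    (n : ℕ) :
    ∑ w ∈ sphere N n, ∑ y, ∑ p ∈ pairs (halfSet φ (o y) y) m, (occ (connect p.1 p.2) w : ℝ) ≤
      ∑ w ∈ sphere N n, (cyclen (φ (mk w)) : ℝ) +
        2 * (∑ y, (pairs (halfSet φ (o y) y) m).card : ℕ) * (sphere N n).card := by
  calc _ ≤ ∑ w ∈ sphere N n, ((cyclen (φ (mk w)) : ℝ) +
          2 * (∑ y, (pairs (halfSet φ (o y) y) m).card : ℕ) *
            (reduceCyclically.conjugator w).length) := by
        refine Finset.sum_le_sum fun w hw => ?_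
        have h := (Nat.cast_le (α := ℝ)).2 (sum_occ_le_cyclen_add φ o hU (mem_sphere.1 hw).2)
        push_cast at h ⊢
        exact h
    _ ≤ _ := by
        rw [Finset.sum_add_distrib, ← Finset.mul_sum]
        exact add_le_add le_rfl (mul_le_mul_of_nonneg_left (sum_conjugator_le hN n) (by positivity))

theorem sum_energy_le_lamA (hN : 2 ≤ N) (φ : MulAut (FreeGroup (Fin N)))
    (o : Fin N × Bool → FreeGroup (Fin N)) {m : ℕ} (hU : ∀ y, LocConst (halfSet φ (o y) y) m) :
    (∑ y, energy (halfSet φ (o y) y) m) / (2 * N) ≤ lamA N (fun w => φ w) := by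
  obtain ⟨K, hK⟩ := exists_cyclen_map_le φ
  set S := ∑ y, energy (halfSet φ (o y) y) m with hS
  set M := ∑ y, (pairs (halfSet φ (o y) y) m).card with hM
  refine le_lamA hN (C := 2 * m * (S / (2 * N)) + 2 * M) hK ?_
  filter_upwards [Filter.eventually_ge_atTop (2 * m + 1)] with n hn
  have hn0 : (0 : ℝ) < n := by exact_mod_cast (show 0 < n by omega)
  have hN0 : (0 : ℝ) < N := by exact_mod_cast (show 0 < N by omega)
  have hcard := card_sphere_pos hN n
  have hq : (0 : ℝ) < ((2 * N - 1 : ℕ) : ℝ) := by exact_mod_cast (show 0 < 2 * N - 1 by omega)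
  rw [avg_eq (by omega)]
  rw [le_div_iff₀ (by positivity)]
  have hcs : ((sphere N n).card : ℝ) = 2 * N * ((2 * N - 1 : ℕ) : ℝ) ^ (n - 1) := by
    rw [card_sphere (by omega)]; push_cast; ring
  have h1 := sum_sum_occ_le hN φ o hU n
  rw [← hM] at h1
  have h2 : (n - 2 * m) * ((2 * N - 1 : ℕ) : ℝ) ^ (n - 1) * S ≤
      ∑ w ∈ sphere N n, ∑ y, ∑ p ∈ pairs (halfSet φ (o y) y) m,
      (occ (connect p.1 p.2) w : ℝ) := by
    rw [Finset.sum_comm, hS, Finset.mul_sum]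
    refine Finset.sum_le_sum fun y _ => ?_
    rw [Finset.sum_comm, energy, Finset.mul_sum]
    refine Finset.sum_le_sum fun p hp => ?_
    obtain ⟨⟨⟨hx, hxr⟩, hz, hzr⟩, -, -⟩ := mem_pairs.1 hp
    have hlt := commonPrefix_lt (hx.trans hz.symm) (ne_of_mem_pairs hp)
    have hlen := length_connect (hx.trans hz.symm)
    have h3 := sum_occ_ge (isReduced_connect (hx.trans hz.symm) (ne_of_mem_pairs hp) hxr hzr)
      (connect_ne_nil hp) (n := n) (by omega)
    set k := commonPrefix p.1 p.2
    set d := (connect p.1 p.2).length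
    have h4 : ((2 * N - 1 : ℕ) : ℝ) ^ (n - 1) * (((2 * N - 1 : ℕ) : ℝ) ^ (2 * k + 1) /
        ((2 * N - 1 : ℕ) : ℝ) ^ (2 * m)) = ((2 * N - 1 : ℕ) : ℝ) ^ (n - d) := by
      rw [← mul_div_assoc, div_eq_iff (by positivity), ← pow_add, ← pow_add]
      congr 1; omega
    rw [mul_assoc, h4]
    calc ((n : ℝ) - 2 * m) * ((2 * N - 1 : ℕ) : ℝ) ^ (n - d)
        ≤ ((n - d + 1 : ℕ) : ℝ) * ((2 * N - 1 : ℕ) : ℝ) ^ (n - d) := by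
          gcongr
          have : n ≤ (n - d + 1) + 2 * m := by omega
          have : (n : ℝ) ≤ ((n - d + 1 : ℕ) : ℝ) + 2 * m := by exact_mod_cast this
          linarith
      _ ≤ _ := by exact_mod_cast h3
  have h5 : (S / (2 * N) - (2 * m * (S / (2 * N)) + 2 * M) / n) * (n * (sphere N n).card) =
      (n - 2 * m) * ((2 * N - 1 : ℕ) : ℝ) ^ (n - 1) * S - 2 * M * (sphere N n).card := by
    rw [hcs]
    field_simp
    ring
  rw [h5]
  linarith

/-! ### Preimages of half-trees are locally constant -/

theorem exists_locConst {U : Set (FreeGroup (Fin N))}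
    (hU : ∀ b : Fin N × Bool, {h | ¬ (h ∈ U ↔ h * mk [b] ∈ U)}.Finite) : ∃ m, LocConst U m := by
  have hfin : (⋃ b : Fin N × Bool, {h | ¬ (h ∈ U ↔ h * mk [b] ∈ U)}).Finite :=
    Set.finite_iUnion hU
  obtain ⟨m, hm⟩ := (hfin.image wlen).bddAbove
  refine ⟨m + 1, fun L hL hl => ?_⟩
  induction L using List.reverseRecOn with
  | nil => simp at hl
  | append_singleton L b ih =>
    by_cases hL' : m + 1 ≤ L.length
    · have hLr : IsReduced L := hL.infix ⟨[], [b], by simp⟩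
      rw [List.take_append_of_le_length hL', ← ih hLr hL', ← mul_mk]
      by_contra hcon
      have : wlen (mk L) ≤ m := hm ⟨mk L, Set.mem_iUnion.2 ⟨b, fun h => hcon h.symm⟩, rfl⟩
      rw [wlen_mk hLr] at this
      omega
    · rw [List.take_of_length_le]
      simp at hl ⊢
      omega

theorem posVar_halfTree_ne_top (g : FreeGroup (Fin N)) (y : Fin N × Bool) :
    posVar g (halfTree y) ≠ ∞ := by
  rw [← mk_toWord (x := g)]
  exact ((posVar_mk_halfTree_le y _).trans_lt (by simp)).ne

theorem finite_of_posVar_indicator_ne_top {U : Set (FreeGroup (Fin N))} {g : FreeGroup (Fin N)}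
    (h : posVar g (U.indicator 1) ≠ ∞) : {h | h ∉ U ∧ h * g ∈ U}.Finite := by
  refine (ENNReal.finite_const_le_of_tsum_ne_top h (ε := 1) (by simp)).subset ?_
  rintro x ⟨hx1, hx2⟩
  simp [hx1, hx2]

theorem exists_locConst_halfSet (φ : MulAut (FreeGroup (Fin N))) (o : FreeGroup (Fin N))
    (y : Fin N × Bool) : ∃ m, LocConst (halfSet φ o y) m := by
  refine exists_locConst fun b => ?_
  have hf : ∀ g, {h | h ∉ halfSet φ o y ∧ h * g ∈ halfSet φ o y}.Finite := fun g =>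
    finite_of_posVar_indicator_ne_top (by
      rw [posVar_indicator_halfSet]; exact posVar_halfTree_ne_top _ _)
  refine ((hf (mk [b])).union ((hf (mk [b])⁻¹).image (· * (mk [b])⁻¹))).subset ?_
  intro h hh
  by_cases h1 : h ∈ halfSet φ o y
  · right
    refine ⟨h * mk [b], ⟨fun h2 => hh (by simp [h1, h2]), ?_⟩, mul_inv_cancel_right _ _⟩
    rwa [mul_inv_cancel_right]
  · left
    refine ⟨h1, ?_⟩
    by_contra h2
    exact hh (by simp [h1, h2])

/-! ### Innermost non-constant branching -/

theorem exists_branching {U : Set (FreeGroup (Fin N))} {m : ℕ} (hU : LocConst U m)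
    {v₀ x₀ z₀ : List (Fin N × Bool)} (hp₀ : (x₀, z₀) ∈ pairs U m) (hx₀ : v₀ <+: x₀)
    (hz₀ : v₀ <+: z₀) :
    ∃ (v : List (Fin N × Bool)) (a b : Fin N × Bool), v₀ <+: v ∧ v.length < m ∧ a ≠ b ∧
      IsReduced (v ++ [a]) ∧ IsReduced (v ++ [b]) ∧
      (∀ L, IsReduced L → m ≤ L.length → v ++ [a] <+: L → mk L ∉ U) ∧
      (∀ L, IsReduced L → m ≤ L.length → v ++ [b] <+: L → mk L ∈ U) := by
  classical
  obtain ⟨⟨x, z⟩, hp, hmax⟩ := Finset.exists_max_image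
    ((pairs U m).filter fun p => v₀ <+: p.1 ∧ v₀ <+: p.2)
    (fun p => commonPrefix p.1 p.2) ⟨(x₀, z₀), Finset.mem_filter.2 ⟨hp₀, hx₀, hz₀⟩⟩
  obtain ⟨hp1, hvx, hvz⟩ := Finset.mem_filter.1 hp
  obtain ⟨⟨⟨hx, hxr⟩, hz, hzr⟩, hxU, hzU⟩ := mem_pairs.1 hp1
  have hne := ne_of_mem_pairs hp1
  dsimp only at hvx hvz hx hxr hz hzr hxU hzU hne
  have hlt := commonPrefix_lt (hx.trans hz.symm) hne
  have hle := le_commonPrefix hvx hvz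
  obtain ⟨g, a, b, x', z', rfl, rfl, hab, hg⟩ := exists_eq_append_of_ne (hx.trans hz.symm) hne
  rw [hg] at hle
  have hv : v₀ <+: g := List.prefix_of_prefix_length_le hvx (List.prefix_append _ _) hle
  have hlen : g.length < m := by rw [← hx, ← hg]; exact hlt
  refine ⟨g, a, b, hv, hlen, hab, hxr.infix ⟨[], x', by simp⟩, hzr.infix ⟨[], z', by simp⟩, ?_, ?_⟩
  · intro L hL hl hpre hLU
    have hL' : IsReduced (L.take m) := hL.infix (List.take_prefix _ _).isInfix
    rw [hU L hL hl] at hLU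
    have hpre' : g ++ [a] <+: L.take m := List.prefix_take_iff.2 ⟨hpre, by simpa using hlen⟩
    have := hmax (g ++ a :: x', L.take m) (Finset.mem_filter.2
      ⟨mem_pairs.2 ⟨⟨⟨hx, hxr⟩, by simp [hl], hL'⟩, hxU, hLU⟩, hvx,
        hv.trans ((List.prefix_append _ _).trans hpre')⟩)
    dsimp only at this
    have h2 := le_commonPrefix (v := g ++ [a]) (x := g ++ a :: x') ⟨x', by simp⟩ hpre'
    simp only [List.length_append, List.length_singleton] at h2
    omega
  · intro L hL hl hpre
    by_contra hLU
    have hL' : IsReduced (L.take m) := hL.infix (List.take_prefix _ _).isInfix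
    rw [hU L hL hl] at hLU
    have hpre' : g ++ [b] <+: L.take m := List.prefix_take_iff.2 ⟨hpre, by simpa using hlen⟩
    have := hmax (L.take m, g ++ b :: z') (Finset.mem_filter.2
      ⟨mem_pairs.2 ⟨⟨⟨by simp [hl], hL'⟩, hz, hzr⟩, hLU, hzU⟩,
        hv.trans ((List.prefix_append _ _).trans hpre'), hvz⟩)
    dsimp only at this
    have h2 := le_commonPrefix (v := g ++ [b]) (z := g ++ b :: z') hpre' ⟨z', by simp⟩
    simp only [List.length_append, List.length_singleton] at h2
    omega

/-- All long words starting with `a` lie outside `U` and all long words starting with `b` inside. -/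
def Separated (U : Set (FreeGroup (Fin N))) (m : ℕ) (a b : Fin N × Bool) : Prop :=
  a ≠ b ∧ (∀ L, IsReduced L → m ≤ L.length → L.head? = some a → mk L ∉ U) ∧
    (∀ L, IsReduced L → m ≤ L.length → L.head? = some b → mk L ∈ U)

theorem Separated.mono {U : Set (FreeGroup (Fin N))} {m m' : ℕ} {a b : Fin N × Bool}
    (h : Separated U m a b) (hm : m ≤ m') : Separated U m' a b :=
  ⟨h.1, fun L hL hl => h.2.1 L hL (hm.trans hl), fun L hL hl => h.2.2 L hL (hm.trans hl)⟩

theorem exists_separated {U : Set (FreeGroup (Fin N))} {m : ℕ} (hU : LocConst U m)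
    (hp : (pairs U m).Nonempty) : ∃ o a b, Separated {h | o * h ∈ U} m a b := by
  obtain ⟨⟨x, z⟩, hp⟩ := hp
  obtain ⟨v, a, b, -, -, hab, ha, hb, h1, h2⟩ :=
    exists_branching hU hp (v₀ := []) List.nil_prefix List.nil_prefix
  have key : ∀ c L, IsReduced (v ++ [c]) → IsReduced L → L.head? = some c →
      IsReduced (v ++ L) ∧ v ++ [c] <+: v ++ L := by
    intro c L hc hL hh
    cases L with
    | nil => simp at hh
    | cons c' L =>
      obtain rfl : c' = c := by simpa using hh
      refine ⟨?_, ⟨L, by simp⟩⟩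
      simpa using hc.append_overlap (L₃ := L) (by simpa using hL) (by simp)
  refine ⟨mk v, a, b, hab, fun L hL hl hh => ?_, fun L hL hl hh => ?_⟩
  · obtain ⟨h3, h4⟩ := key a L ha hL hh
    simpa [mul_mk] using h1 (v ++ L) h3 (by simp; omega) h4
  · obtain ⟨h3, h4⟩ := key b L hb hL hh
    simpa [mul_mk] using h2 (v ++ L) h3 (by simp; omega) h4

/-! ### Lower bounds for the energy -/

open Classical in
theorem card_pairs (U : Set (FreeGroup (Fin N))) (m : ℕ) :
    (pairs U m).card = ((sphere N m).filter fun x => mk x ∉ U).card *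
      ((sphere N m).filter fun x => mk x ∈ U).card := by
  rw [← Finset.card_product, ← Finset.filter_product]
  rfl

open Classical in
theorem card_filter_prefix_ge {v : List (Fin N × Bool)} (hv : IsReduced v) (hne : v ≠ []) {m : ℕ}
    (hm : v.length ≤ m) :
    (2 * N - 1) ^ (m - v.length) ≤ ((sphere N m).filter fun x => v <+: x).card := by
  rw [← card_extensions hv hne, ← Finset.card_map ⟨fun r => v ++ r, List.append_right_injective v⟩]
  refine Finset.card_le_card fun x hx => ?_
  obtain ⟨r, hr, rfl⟩ := Finset.mem_map.1 hx
  rw [mem_extensions] at hr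
  rw [Finset.mem_filter, mem_sphere]
  exact ⟨⟨by simp [hr.1, hm], hr.2⟩, List.prefix_append _ _⟩

open Classical in
theorem card_filter_head_ge {P : FreeGroup (Fin N) → Prop} {m : ℕ} (hm : 1 ≤ m)
    (s : Finset (Fin N × Bool))
    (h : ∀ c ∈ s, ∀ L ∈ sphere N m, L.head? = some c → P (mk L)) :
    s.card * (2 * N - 1) ^ (m - 1) ≤ ((sphere N m).filter fun x => P (mk x)).card := by
  calc s.card * (2 * N - 1) ^ (m - 1)
      ≤ ∑ c ∈ s, ((sphere N m).filter fun x => [c] <+: x).card := by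
        rw [← smul_eq_mul]
        refine Finset.card_nsmul_le_sum _ _ _ fun c _ => ?_
        simpa using card_filter_prefix_ge (v := [c]) (by simp) (by simp) (m := m) (by simpa using hm)
    _ = (s.biUnion fun c => (sphere N m).filter fun x => [c] <+: x).card := by
        rw [Finset.card_biUnion]
        intro c _ c' _ hcc
        rw [Function.onFun, Finset.disjoint_left]
        intro x hx hx'
        obtain ⟨_, r, rfl⟩ := Finset.mem_filter.1 hx
        obtain ⟨_, r', hr'⟩ := Finset.mem_filter.1 hx'
        simp only [List.singleton_append, List.cons.injEq] at hr'
        exact hcc hr'.1.symm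
    _ ≤ _ := by
        refine Finset.card_le_card fun x hx => ?_
        obtain ⟨c, hc, hx⟩ := Finset.mem_biUnion.1 hx
        obtain ⟨hx1, r, rfl⟩ := Finset.mem_filter.1 hx
        exact Finset.mem_filter.2 ⟨hx1, h c hc _ hx1 (by simp)⟩

open Classical in
theorem card_filter_add (U : Set (FreeGroup (Fin N))) {m : ℕ} (hm : 1 ≤ m) :
    ((sphere N m).filter fun x => mk x ∉ U).card + ((sphere N m).filter fun x => mk x ∈ U).card =
      2 * N * (2 * N - 1) ^ (m - 1) := by
  rw [add_comm, Finset.card_filter_add_card_filter_not, card_sphere hm]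

theorem card_pairs_ge {U : Set (FreeGroup (Fin N))} {m : ℕ} (hN : 2 ≤ N) (hm : 1 ≤ m) {t : ℕ}
    (s s' : Finset (Fin N × Bool)) (ht : t ≤ s.card) (ht' : t ≤ s'.card)
    (hs : ∀ c ∈ s, ∀ L ∈ sphere N m, L.head? = some c → mk L ∉ U)
    (hs' : ∀ c ∈ s', ∀ L ∈ sphere N m, L.head? = some c → mk L ∈ U) :
    (t : ℝ) * (2 * N - t) ≤
      (pairs U m).card * ((2 * N - 1 : ℕ) : ℝ) ^ 2 / ((2 * N - 1 : ℕ) : ℝ) ^ (2 * m) := by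
  classical
  have hA := card_filter_head_ge (P := fun h => h ∉ U) hm s hs
  have hB := card_filter_head_ge (P := fun h => h ∈ U) hm s' hs'
  have hAB := card_filter_add U hm
  rw [card_pairs]
  set A := ((sphere N m).filter fun x => mk x ∉ U).card
  set B := ((sphere N m).filter fun x => mk x ∈ U).card
  have hq : (0 : ℝ) < ((2 * N - 1 : ℕ) : ℝ) := by exact_mod_cast (show 0 < 2 * N - 1 by omega)
  have hA' : (t : ℝ) * ((2 * N - 1 : ℕ) : ℝ) ^ (m - 1) ≤ A := by
    have h : t * (2 * N - 1) ^ (m - 1) ≤ A := by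
      refine ((Nat.mul_le_mul_right _ ht).trans hA).trans (le_of_eq ?_)
      congr
    exact_mod_cast h
  have hB' : (t : ℝ) * ((2 * N - 1 : ℕ) : ℝ) ^ (m - 1) ≤ B := by
    exact_mod_cast (Nat.mul_le_mul_right _ ht').trans hB
  have hAB' : (A : ℝ) + B = 2 * N * ((2 * N - 1 : ℕ) : ℝ) ^ (m - 1) := by exact_mod_cast hAB
  have hpow : ((2 * N - 1 : ℕ) : ℝ) ^ (2 * m) =
      (((2 * N - 1 : ℕ) : ℝ) ^ (m - 1)) ^ 2 * ((2 * N - 1 : ℕ) : ℝ) ^ 2 := by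
    rw [← pow_mul, ← pow_add]; congr 1; omega
  rw [le_div_iff₀ (by positivity), hpow]
  set q := ((2 * N - 1 : ℕ) : ℝ)
  set Q := q ^ (m - 1)
  have h1 : (t : ℝ) * (2 * N - t) * Q ^ 2 ≤ A * B := by
    nlinarith [mul_nonneg (sub_nonneg.2 hA') (sub_nonneg.2 hB')]
  push_cast
  nlinarith [sq_nonneg q]

theorem card_pairs_mul_le_energy (hN : 2 ≤ N) (U : Set (FreeGroup (Fin N))) (m : ℕ) :
    (pairs U m).card * ((2 * N - 1 : ℕ) : ℝ) ^ 1 / ((2 * N - 1 : ℕ) : ℝ) ^ (2 * m) ≤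
      energy U m := by
  rw [energy, mul_div_assoc, ← nsmul_eq_mul]
  refine Finset.card_nsmul_le_sum _ _ _ fun p _ => ?_
  have hq : (1 : ℝ) ≤ ((2 * N - 1 : ℕ) : ℝ) := by exact_mod_cast (show 1 ≤ 2 * N - 1 by omega)
  gcongr
  omega

theorem le_energy_of_heads (hN : 2 ≤ N) {U : Set (FreeGroup (Fin N))} {m : ℕ} (hm : 1 ≤ m) {t : ℕ}
    (s s' : Finset (Fin N × Bool)) (ht : t ≤ s.card) (ht' : t ≤ s'.card)
    (hs : ∀ c ∈ s, ∀ L ∈ sphere N m, L.head? = some c → mk L ∉ U)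
    (hs' : ∀ c ∈ s', ∀ L ∈ sphere N m, L.head? = some c → mk L ∈ U) :
    (t : ℝ) * (2 * N - t) / ((2 * N - 1 : ℕ) : ℝ) ≤
      (pairs U m).card * ((2 * N - 1 : ℕ) : ℝ) ^ 1 / ((2 * N - 1 : ℕ) : ℝ) ^ (2 * m) := by
  have hq : (0 : ℝ) < ((2 * N - 1 : ℕ) : ℝ) := by exact_mod_cast (show 0 < 2 * N - 1 by omega)
  rw [div_le_iff₀ hq]
  refine (card_pairs_ge hN hm s s' ht ht' hs hs').trans (le_of_eq ?_)
  ring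

theorem one_le_of_separated (hN : 2 ≤ N) {U : Set (FreeGroup (Fin N))} {m : ℕ} (hm : 1 ≤ m)
    {a b : Fin N × Bool} (h : Separated U m a b) :
    1 ≤ (pairs U m).card * ((2 * N - 1 : ℕ) : ℝ) ^ 1 / ((2 * N - 1 : ℕ) : ℝ) ^ (2 * m) := by
  have h1 := le_energy_of_heads hN hm (U := U) (t := 1) {a} {b} (by simp) (by simp)
    (fun c hc L hL hh => h.2.1 L (mem_sphere.1 hL).2 (mem_sphere.1 hL).1.ge
      (by rw [hh, Finset.mem_singleton.1 hc]))
    (fun c hc L hL hh => h.2.2 L (mem_sphere.1 hL).2 (mem_sphere.1 hL).1.ge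
      (by rw [hh, Finset.mem_singleton.1 hc]))
  refine le_trans (le_of_eq ?_) h1
  have hq : ((2 * N - 1 : ℕ) : ℝ) = 2 * N - 1 := by
    rw [Nat.cast_sub (by omega)]; push_cast; ring
  have h2 : (2 : ℝ) ≤ N := by exact_mod_cast hN
  rw [hq]
  push_cast
  rw [one_mul, div_self (by linarith)]

/-- The excess of energy coming from a branch on which `U` is not constant. -/
theorem energy_ge_of_nonconstant_branch (hN : 2 ≤ N) {U : Set (FreeGroup (Fin N))} {m : ℕ}
    (hU : LocConst U m) {x z : List (Fin N × Bool)} {c : Fin N × Bool} (hp : (x, z) ∈ pairs U m)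
    (hx : [c] <+: x) (hz : [c] <+: z) :
    (pairs U m).card * ((2 * N - 1 : ℕ) : ℝ) ^ 1 / ((2 * N - 1 : ℕ) : ℝ) ^ (2 * m) +
      1 / (2 * ((2 * N - 1 : ℕ) : ℝ)) ≤ energy U m := by
  classical
  obtain ⟨v, a, b, hv, hlen, hab, ha, hb, h1, h2⟩ := exists_branching hU hp hx hz
  have hvl : 1 ≤ v.length := by simpa using hv.length_le
  set q := ((2 * N - 1 : ℕ) : ℝ) with hqdef
  have hq : (3 : ℝ) ≤ q := by
    rw [hqdef]; exact_mod_cast (show 3 ≤ 2 * N - 1 by omega)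
  set j := v.length with hj
  let T := ((sphere N m).filter fun x => v ++ [a] <+: x) ×ˢ
    ((sphere N m).filter fun x => v ++ [b] <+: x)
  have hT : T ⊆ pairs U m := by
    intro p hp
    obtain ⟨hp1, hp2⟩ := Finset.mem_product.1 hp
    obtain ⟨hp1, hp1'⟩ := Finset.mem_filter.1 hp1
    obtain ⟨hp2, hp2'⟩ := Finset.mem_filter.1 hp2
    rw [mem_sphere] at hp1 hp2
    exact mem_pairs.2 ⟨⟨hp1, hp2⟩, h1 _ hp1.2 hp1.1.ge hp1', h2 _ hp2.2 hp2.1.ge hp2'⟩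
  have hTcard : q ^ (2 * (m - j - 1)) ≤ T.card := by
    have e1 := card_filter_prefix_ge ha (by simp) (m := m) (by simp; omega)
    have e2 := card_filter_prefix_ge hb (by simp) (m := m) (by simp; omega)
    simp only [List.length_append, List.length_singleton, ← Nat.sub_sub, ← hj] at e1 e2
    rw [two_mul, pow_add, Finset.card_product]
    push_cast
    gcongr
    · rw [hqdef]; exact_mod_cast e1
    · rw [hqdef]; exact_mod_cast e2
  have hle : ∀ p ∈ T, (q ^ (2 * j + 1) - q ^ 1) / q ^ (2 * m) ≤
      (q ^ (2 * commonPrefix p.1 p.2 + 1) - q ^ 1) / q ^ (2 * m) := by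
    intro p hp
    obtain ⟨hp1, hp2⟩ := Finset.mem_product.1 hp
    have hp1' := (Finset.mem_filter.1 hp1).2
    have hp2' := (Finset.mem_filter.1 hp2).2
    have := le_commonPrefix ((List.prefix_append _ _).trans hp1')
      ((List.prefix_append _ _).trans hp2')
    gcongr
    linarith
  have hexc : T.card * ((q ^ (2 * j + 1) - q ^ 1) / q ^ (2 * m)) ≤
      ∑ p ∈ pairs U m, (q ^ (2 * commonPrefix p.1 p.2 + 1) - q ^ 1) / q ^ (2 * m) := by
    rw [← nsmul_eq_mul]
    refine (Finset.card_nsmul_le_sum _ _ _ hle).trans ?_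
    refine Finset.sum_le_sum_of_subset_of_nonneg hT fun p _ _ => ?_
    apply div_nonneg _ (by positivity)
    rw [sub_nonneg]
    exact pow_le_pow_right₀ (by linarith) (by omega)
  have hsplit : energy U m = (pairs U m).card * q ^ 1 / q ^ (2 * m) +
      ∑ p ∈ pairs U m, (q ^ (2 * commonPrefix p.1 p.2 + 1) - q ^ 1) / q ^ (2 * m) := by
    simp only [sub_div, Finset.sum_sub_distrib, Finset.sum_const, nsmul_eq_mul, energy]
    rw [← hqdef, mul_div_assoc]; ring
  rw [hsplit]
  gcongr
  refine le_trans ?_ hexc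
  have hnum : 0 ≤ (q ^ (2 * j + 1) - q ^ 1) / q ^ (2 * m) := by
    apply div_nonneg _ (by positivity)
    rw [sub_nonneg]
    exact pow_le_pow_right₀ (by linarith) (by omega)
  refine le_trans ?_ (mul_le_mul_of_nonneg_right hTcard hnum)
  have e3 : q ^ (2 * m) = q ^ (2 * (m - j - 1)) * q ^ (2 * j + 1) * q := by
    rw [← pow_add, ← pow_succ]; congr 1; omega
  have e4 : q ^ (2 * j + 1) = q ^ (2 * (j - 1)) * q ^ 3 := by
    rw [← pow_add]; congr 1; omega
  have e5 : (1 : ℝ) ≤ q ^ (2 * (j - 1)) := one_le_pow₀ (by linarith)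
  rw [e3, ← mul_div_assoc, div_le_div_iff₀ (by positivity) (by positivity)]
  have e6 : 2 * q ≤ q ^ (2 * j + 1) := by
    rw [e4]
    nlinarith [mul_nonneg (sub_nonneg.2 e5) (by positivity : 0 ≤ q ^ 3), sq_nonneg (q - 3)]
  have e7 : 0 < q ^ (2 * (m - j - 1)) * q := by positivity
  nlinarith [mul_nonneg e7.le (sub_nonneg.2 e6)]

/-- Energy gap: either the energy exceeds `1` by a definite amount, or `U` agrees up to finitely many
elements with a half-tree or the complement of one. -/
theorem energy_gap (hN : 2 ≤ N) {U : Set (FreeGroup (Fin N))} {m : ℕ} (hm : 1 ≤ m)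
    (hU : LocConst U m) {a b : Fin N × Bool} (hs : Separated U m a b) :
    1 + 1 / (2 * ((2 * N - 1 : ℕ) : ℝ)) ≤ energy U m ∨
      (∀ L, IsReduced L → m ≤ L.length → (mk L ∈ U ↔ L.head? = some b)) ∨
      (∀ L, IsReduced L → m ≤ L.length → (mk L ∈ U ↔ ¬ L.head? = some a)) := by
  classical
  by_cases hbranch : ∃ x z, (x, z) ∈ pairs U m ∧ x.head? = z.head?
  · left
    obtain ⟨x, z, hp, hh⟩ := hbranch
    obtain ⟨⟨⟨hx, hxr⟩, hz, hzr⟩, -, -⟩ := mem_pairs.1 hp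
    dsimp only at hx hz
    cases x with
    | nil => simp at hx; omega
    | cons c x =>
      cases z with
      | nil => simp at hz; omega
      | cons c' z =>
        obtain rfl : c = c' := by simpa using hh
        refine le_trans ?_ (energy_ge_of_nonconstant_branch hN hU hp (c := c) ⟨x, rfl⟩ ⟨z, rfl⟩)
        gcongr
        exact one_le_of_separated hN hm hs
  push Not at hbranch
  set K : Finset (Fin N × Bool) :=
    Finset.univ.filter fun c => ∃ L ∈ sphere N m, L.head? = some c ∧ mk L ∈ U with hK
  have hin : ∀ c ∈ K, ∀ L ∈ sphere N m, L.head? = some c → mk L ∈ U := by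
    intro c hc L hL hh
    obtain ⟨L', hL', hh', hU'⟩ := (Finset.mem_filter.1 hc).2
    by_contra hcon
    exact hbranch L L' (mem_pairs.2 ⟨⟨mem_sphere.1 hL, mem_sphere.1 hL'⟩, hcon, hU'⟩)
      (hh.trans hh'.symm)
  have hout : ∀ c ∈ Kᶜ, ∀ L ∈ sphere N m, L.head? = some c → mk L ∉ U := by
    intro c hc L hL hh hLU
    rw [Finset.mem_compl] at hc
    exact hc (Finset.mem_filter.2 ⟨Finset.mem_univ _, L, hL, hh, hLU⟩)
  have hex : ∀ c : Fin N × Bool, ∃ L ∈ sphere N m, L.head? = some c := by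
    intro c
    have h1 := card_filter_prefix_ge (v := [c]) (by simp) (by simp) (m := m) (by simpa using hm)
    have h2 : 0 < (2 * N - 1) ^ (m - [c].length) := by
      have : 0 < 2 * N - 1 := by omega
      positivity
    obtain ⟨L, hL⟩ := Finset.card_pos.1 (h2.trans_le h1)
    obtain ⟨hL, r, rfl⟩ := Finset.mem_filter.1 hL
    exact ⟨_, hL, by simp⟩
  have hbK : b ∈ K := by
    obtain ⟨L, hL, hh⟩ := hex b
    exact Finset.mem_filter.2 ⟨Finset.mem_univ _, L, hL, hh,
      hs.2.2 L (mem_sphere.1 hL).2 (mem_sphere.1 hL).1.ge hh⟩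
  have haK : a ∈ Kᶜ := by
    rw [Finset.mem_compl]
    intro ha
    obtain ⟨L, hL, hh⟩ := hex a
    exact hs.2.1 L (mem_sphere.1 hL).2 (mem_sphere.1 hL).1.ge hh (hin a ha L hL hh)
  have hiff : ∀ L, IsReduced L → m ≤ L.length → ∃ c, L.head? = some c ∧ (mk L ∈ U ↔ c ∈ K) := by
    intro L hL hl
    cases L with
    | nil => simp at hl; omega
    | cons c L =>
      refine ⟨c, rfl, ?_⟩
      rw [hU _ hL hl]
      have hmem : (c :: L).take m ∈ sphere N m :=
        mem_sphere.2 ⟨by rw [List.length_take, min_eq_left hl],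
          hL.infix (List.take_prefix _ _).isInfix⟩
      have hhead : ((c :: L).take m).head? = some c := by
        obtain ⟨m', rfl⟩ := Nat.exists_eq_add_of_le' hm
        simp
      refine ⟨fun h => ?_, fun h => hin c h _ hmem hhead⟩
      by_contra hc
      exact hout c (Finset.mem_compl.2 hc) _ hmem hhead h
  by_cases h2 : 2 ≤ Kᶜ.card ∧ 2 ≤ K.card
  · left
    refine le_trans ?_ ((le_energy_of_heads hN hm (U := U) Kᶜ K h2.1 h2.2 hout hin).trans
      (card_pairs_mul_le_energy hN U m))
    have hq : ((2 * N - 1 : ℕ) : ℝ) = 2 * N - 1 := by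
      rw [Nat.cast_sub (by omega)]; push_cast; ring
    have h3 : (2 : ℝ) ≤ N := by exact_mod_cast hN
    rw [hq]
    push_cast
    rw [le_div_iff₀ (by linarith), add_mul, one_mul, div_mul_eq_mul_div, one_mul]
    have : (2 * (N : ℝ) - 1) / (2 * (2 * N - 1)) = 1 / 2 := by
      rw [div_eq_div_iff (by linarith) (by norm_num)]; ring
    rw [this]
    linarith
  · right
    by_cases h3 : 2 ≤ Kᶜ.card
    · left
      have hK1 : K.card ≤ 1 := by
        by_contra h4; exact h2 ⟨h3, by omega⟩
      intro L hL hl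
      obtain ⟨c, hc, hcK⟩ := hiff L hL hl
      rw [hcK, hc, Option.some.injEq]
      exact ⟨fun h => Finset.card_le_one.1 hK1 c h b hbK, fun h => h ▸ hbK⟩
    · right
      intro L hL hl
      obtain ⟨c, hc, hcK⟩ := hiff L hL hl
      rw [hcK, hc, Option.some.injEq]
      refine ⟨fun h h' => Finset.mem_compl.1 haK (h' ▸ h), fun h => ?_⟩
      by_contra h'
      exact h (Finset.card_le_one.1 (by omega) c (Finset.mem_compl.2 h') a haK)

/-! ### The lower bound for the stretching factor -/

theorem finite_wlen_lt (m : ℕ) : {h : FreeGroup (Fin N) | wlen h < m}.Finite := by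
  refine (((Finset.range m).biUnion fun k => sphere N k).finite_toSet.image mk).subset ?_
  intro h hh
  refine ⟨h.toWord, ?_, mk_toWord⟩
  simp only [Finset.coe_biUnion, Set.mem_iUnion, Finset.mem_coe, Finset.mem_range]
  exact ⟨wlen h, hh, mem_sphere.2 ⟨rfl, isReduced_toWord⟩⟩

theorem infinite_setOf_head (y : Fin N × Bool) :
    {h : FreeGroup (Fin N) | h.toWord.head? = some y}.Infinite := by
  have hr : ∀ k, (mk (List.replicate k y)).toWord = List.replicate k y := fun k =>
    toWord_mk_of_isReduced (List.isChain_replicate_of_rel _ fun _ => rfl)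
  refine Set.infinite_of_injective_forall_mem (f := fun k : ℕ => mk (List.replicate (k + 1) y))
    (fun k l h => ?_) fun k => ?_
  · have := congrArg (fun g => g.toWord.length) h
    simpa [hr] using this
  · rw [Set.mem_ofPred_eq, hr]; rfl

theorem infinite_halfSet (φ : MulAut (FreeGroup (Fin N))) (o : FreeGroup (Fin N))
    (y : Fin N × Bool) : (halfSet φ o y).Infinite := by
  have h : halfSet φ o y = ((Equiv.mulLeft o).trans φ.toEquiv) ⁻¹' {h | h.toWord.head? = some y} :=
    rfl
  rw [h]
  exact (infinite_setOf_head y).preimage (by rw [Equiv.range_eq_univ]; exact Set.subset_univ _)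

theorem infinite_halfSet_compl (φ : MulAut (FreeGroup (Fin N))) (o : FreeGroup (Fin N))
    (y : Fin N × Bool) : (halfSet φ o y)ᶜ.Infinite := by
  refine (infinite_halfSet φ o (y.1, !y.2)).mono fun h hh hh' => ?_
  have h1 : (φ (o * h)).toWord.head? = some (y.1, !y.2) := hh
  have h2 : (φ (o * h)).toWord.head? = some y := hh'
  rw [h1, Option.some.injEq, Prod.ext_iff] at h2
  simp at h2

theorem exists_mem_sphere_of_infinite {U V : Set (FreeGroup (Fin N))} {m : ℕ} (hU : LocConst U m)
    (hV : V.Infinite) : ∃ h ∈ V, ∃ x, (x.length = m ∧ IsReduced x) ∧ (h ∈ U ↔ mk x ∈ U) := by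
  obtain ⟨h, hh, hm⟩ := hV.exists_notMem_finite (finite_wlen_lt m)
  rw [Set.mem_ofPred_eq, not_lt] at hm
  refine ⟨h, hh, h.toWord.take m, ⟨by rw [List.length_take]; exact min_eq_left hm,
    isReduced_toWord.infix (List.take_prefix _ _).isInfix⟩, ?_⟩
  rw [← hU _ isReduced_toWord hm, mk_toWord]

theorem pairs_halfSet_nonempty {φ : MulAut (FreeGroup (Fin N))} {o : FreeGroup (Fin N)}
    {y : Fin N × Bool} {m : ℕ} (hU : LocConst (halfSet φ o y) m) :
    (pairs (halfSet φ o y) m).Nonempty := by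
  obtain ⟨h, hh, x, hx, hhx⟩ := exists_mem_sphere_of_infinite hU (infinite_halfSet_compl φ o y)
  obtain ⟨h', hh', x', hx', hhx'⟩ := exists_mem_sphere_of_infinite hU (infinite_halfSet φ o y)
  exact ⟨(x, x'), mem_pairs.2 ⟨⟨hx, hx'⟩, fun h => hh (hhx.2 h), hhx'.1 hh'⟩⟩

theorem exists_separated_halfSet (φ : MulAut (FreeGroup (Fin N))) (y : Fin N × Bool) :
    ∃ o m a b, Separated (halfSet φ o y) m a b ∧ LocConst (halfSet φ o y) m := by
  obtain ⟨m, hm⟩ := exists_locConst_halfSet φ 1 y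
  obtain ⟨o, a, b, h⟩ := exists_separated hm (pairs_halfSet_nonempty hm)
  obtain ⟨m', hm'⟩ := exists_locConst_halfSet φ o y
  refine ⟨o, max m m', a, b, ?_, hm'.mono (le_max_right _ _)⟩
  have he : {h | o * h ∈ halfSet φ 1 y} = halfSet φ o y := by
    ext h; simp [halfSet]
  rw [he] at h
  exact h.mono (le_max_left _ _)

theorem tsum_ne_top_of_eq {o : FreeGroup (Fin N)} {m : ℕ} {u v : FreeGroup (Fin N) → ℝ}
    (h : ∀ k, m ≤ wlen k → u (o * k) = v (o * k)) :
    ∑' h, ENNReal.ofReal |u h - v h| ≠ ∞ := by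
  rw [tsum_eq_sum (s := ((finite_wlen_lt m).image (o * ·)).toFinset)]
  · exact (ENNReal.sum_lt_top.2 fun _ _ => ENNReal.ofReal_lt_top).ne
  · intro b hb
    have h1 : m ≤ wlen (o⁻¹ * b) := by
      by_contra hlt
      refine hb ((Set.Finite.mem_toFinset _).2 ⟨o⁻¹ * b, not_le.1 hlt, by simp⟩)
    have h2 := h _ h1
    rw [mul_inv_cancel_left] at h2
    simp [h2]

/-- Up to finitely many elements, `halfTree y ∘ φ` looks like a half-tree with root letter `β`. -/
def IsHalfTreeLike (φ : MulAut (FreeGroup (Fin N))) (y β : Fin N × Bool) : Prop :=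
  ∃ u : FreeGroup (Fin N) → ℝ, ∑' h, ENNReal.ofReal |halfTree y (φ h) - u h| ≠ ∞ ∧
    ∀ c, posVar (mk [c]) u ≤ if c = β then 1 else 0

theorem isHalfTreeLike_of_head {φ : MulAut (FreeGroup (Fin N))} {o : FreeGroup (Fin N)}
    {y b : Fin N × Bool} {m : ℕ}
    (h : ∀ L, IsReduced L → m ≤ L.length → (mk L ∈ halfSet φ o y ↔ L.head? = some b)) :
    IsHalfTreeLike φ y b := by
  refine ⟨fun h => halfTree b (o⁻¹ * h), tsum_ne_top_of_eq (o := o) (m := m) fun k hk => ?_,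
    fun c => ?_⟩
  · have h1 := h k.toWord isReduced_toWord hk
    rw [mk_toWord] at h1
    rw [inv_mul_cancel_left, halfTree, halfTree]
    exact if_congr h1 rfl rfl
  · rw [posVar_translate o⁻¹ _ (halfTree b)]
    exact posVar_halfTree_le b c

theorem isHalfTreeLike_of_not_head {φ : MulAut (FreeGroup (Fin N))} {o : FreeGroup (Fin N)}
    {y a : Fin N × Bool} {m : ℕ}
    (h : ∀ L, IsReduced L → m ≤ L.length → (mk L ∈ halfSet φ o y ↔ ¬ L.head? = some a)) :
    IsHalfTreeLike φ y (a.1, !a.2) := by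
  refine ⟨fun h => 1 + -halfTree a (o⁻¹ * h), tsum_ne_top_of_eq (o := o) (m := m) fun k hk => ?_,
    fun c => ?_⟩
  · have h1 := h k.toWord isReduced_toWord hk
    rw [mk_toWord] at h1
    have h2 : (φ (o * k)).toWord.head? = some y ↔ ¬ k.toWord.head? = some a := h1
    rw [inv_mul_cancel_left, halfTree, halfTree, if_congr h2 rfl rfl]
    split_ifs <;> simp_all
  · rw [posVar_const_add _ 1 fun h => -halfTree a (o⁻¹ * h),
      posVar_neg _ fun h => halfTree a (o⁻¹ * h), posVar_translate o⁻¹ _ (halfTree a)]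
    have h1 : (mk [c])⁻¹ = mk [(c.1, !c.2)] := by rw [inv_mk]; rfl
    rw [h1]
    refine (posVar_halfTree_le a _).trans (le_of_eq (if_congr ?_ rfl rfl))
    rw [Prod.ext_iff, Prod.ext_iff]
    simp only [Bool.not_eq_eq_eq_not]

/-- Either the `y`-coordinate of `φ` has an energy surplus, or it looks like a half-tree. -/
theorem energy_dichotomy (hN : 2 ≤ N) (φ : MulAut (FreeGroup (Fin N))) (y : Fin N × Bool) :
    ∃ o m, ∀ M, m ≤ M → LocConst (halfSet φ o y) M ∧ 1 ≤ energy (halfSet φ o y) M ∧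
      ((∃ β, IsHalfTreeLike φ y β) ∨
        1 + 1 / (2 * ((2 * N - 1 : ℕ) : ℝ)) ≤ energy (halfSet φ o y) M) := by
  obtain ⟨o, m, a, b, hs, hU⟩ := exists_separated_halfSet φ y
  refine ⟨o, m + 1, fun M hM => ⟨hU.mono (by omega), ?_, ?_⟩⟩
  · exact (one_le_of_separated hN (by omega) (hs.mono (by omega : m ≤ M))).trans
      (card_pairs_mul_le_energy hN _ _)
  · rcases energy_gap hN (by omega) (hU.mono (by omega : m ≤ M)) (hs.mono (by omega : m ≤ M)) with
      h | h | h
    · exact Or.inr h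
    · exact Or.inl ⟨_, isHalfTreeLike_of_head h⟩
    · exact Or.inl ⟨_, isHalfTreeLike_of_not_head h⟩

/-- The stretching factor is at least one, with a definite gap unless every coordinate of the
automorphism looks like a half-tree. -/
theorem lamA_gap (hN : 2 ≤ N) (φ : MulAut (FreeGroup (Fin N))) :
    1 ≤ lamA N (fun w => φ w) ∧ ((∀ y, ∃ β, IsHalfTreeLike φ y β) ∨
      1 + 1 / (2 * ((2 * N - 1 : ℕ) : ℝ)) / (2 * N) ≤ lamA N (fun w => φ w)) := by
  choose o m h using energy_dichotomy hN φ
  set M := ∑ y, m y with hM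
  have hmM : ∀ y, m y ≤ M := fun y =>
    Finset.single_le_sum (f := m) (fun _ _ => Nat.zero_le _) (Finset.mem_univ y)
  have hlam := sum_energy_le_lamA hN φ o (m := M) fun y => (h y M (hmM y)).1
  have hN0 : (0 : ℝ) < 2 * N := by have : (2 : ℝ) ≤ N := by exact_mod_cast hN
                                   linarith
  have hcard : ∑ _y : Fin N × Bool, (1 : ℝ) = 2 * N := by simp [mul_comm]
  refine ⟨?_, ?_⟩
  · refine le_trans ?_ hlam
    rw [le_div_iff₀ hN0, one_mul, ← hcard]
    exact Finset.sum_le_sum fun y _ => (h y M (hmM y)).2.1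
  · by_cases hβ : ∀ y, ∃ β, IsHalfTreeLike φ y β
    · exact Or.inl hβ
    · right
      push Not at hβ
      obtain ⟨y, hy⟩ := hβ
      refine le_trans ?_ hlam
      have hy' := (h y M (hmM y)).2.2.resolve_left (fun ⟨β, hβ⟩ => hy β hβ)
      rw [le_div_iff₀ hN0, add_mul, one_mul, div_mul_cancel₀ _ hN0.ne', ← hcard,
        ← Finset.add_sum_erase _ _ (Finset.mem_univ y),
        ← Finset.add_sum_erase _ _ (Finset.mem_univ y)]
      have : ∑ x ∈ Finset.univ.erase y, (1 : ℝ) ≤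
          ∑ x ∈ Finset.univ.erase y, energy (halfSet φ (o x) x) M :=
        Finset.sum_le_sum fun y _ => (h y M (hmM y)).2.1
      linarith

theorem eq_one_of_cyclen_eq_zero {w : FreeGroup (Fin N)} (h : cyclen w = 0) : w = 1 := by
  obtain ⟨g, hg⟩ := exists_conj_eq_cyclen w
  rw [h, wlen, List.length_eq_zero_iff, toWord_eq_nil_iff] at hg
  exact conj_eq_one_iff.1 hg

theorem cyclen_map_le_of_isHalfTreeLike {φ : MulAut (FreeGroup (Fin N))}
    (h : ∀ y, ∃ β, IsHalfTreeLike φ y β) (g : FreeGroup (Fin N)) :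
    cyclen (φ g) ≤ cyclen g := by
  choose β u hu hpos using h
  have h1 : ∀ L : List (Fin N × Bool), cyclen (φ (mk L)) ≤ ∑ y, L.count (β y) := by
    intro L
    have h2 := cyclen_le_sum_posVar φ u hu L
    have h3 : ∀ y, (L.map fun b => posVar (mk [b]) (u y)).sum ≤ ((L.count (β y) : ℕ) : ℝ≥0∞) := by
      intro y
      induction L with
      | nil => simp
      | cons b L ih =>
        rw [List.map_cons, List.sum_cons, List.count_cons, add_comm]
        push_cast
        refine add_le_add (ih (cyclen_le_sum_posVar φ u hu L)) ((hpos y b).trans (le_of_eq ?_))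
        simp
    have h4 := h2.trans (Finset.sum_le_sum fun y _ => h3 y)
    exact_mod_cast h4
  have hsurj : Function.Surjective β := by
    intro c
    by_contra hc
    push Not at hc
    have h2 := h1 [c]
    have h3 : ∑ y, [c].count (β y) = 0 := Finset.sum_eq_zero fun y _ => by
      rw [List.count_eq_zero]; simpa using hc y
    rw [h3, Nat.le_zero] at h2
    have h4 := eq_one_of_cyclen_eq_zero h2
    rw [EmbeddingLike.map_eq_one_iff, ← toWord_eq_nil_iff, toWord_mk] at h4
    simp at h4
  have hbij : Function.Bijective β := hsurj.bijective_of_finite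
  have h5 : ∀ g, (cyclen (φ.toMonoidHom g) : ℝ) ≤ 1 * wlen g := by
    intro g
    have h6 := h1 g.toWord
    rw [mk_toWord, hbij.sum_comp fun y => g.toWord.count y,
      sum_count_eq_length] at h6
    rw [one_mul]
    exact_mod_cast h6
  have h7 := cyclen_map_le_of_wlen_map_le φ.toMonoidHom h5 g
  rw [one_mul] at h7
  exact_mod_cast h7

theorem cyclen_inv_map_le {φ : MulAut (FreeGroup (Fin N))}
    (h : ∀ g, cyclen (φ g) ≤ cyclen g) (g : FreeGroup (Fin N)) : cyclen (φ⁻¹ g) ≤ cyclen g := by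
  have hpow : ∀ k : ℕ, cyclen ((φ ^ k) g) ≤ cyclen g := by
    intro k
    induction k with
    | zero => simp
    | succ k ih => rw [pow_succ', MulAut.mul_apply]; exact (h _).trans ih
  choose c hc using fun k : ℕ => exists_conj_eq_cyclen ((φ ^ k) g)
  have : Finite {h : FreeGroup (Fin N) | wlen h < cyclen g + 1} := (finite_wlen_lt _).to_subtype
  let F : ℕ → {h : FreeGroup (Fin N) | wlen h < cyclen g + 1} := fun k =>
    ⟨c k * (φ ^ k) g * (c k)⁻¹, by
      rw [Set.mem_ofPred_eq, hc]; exact Nat.lt_succ_of_le (hpow k)⟩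
  obtain ⟨k, l, hkl, hF⟩ : ∃ k l, k < l ∧ F k = F l := by
    obtain ⟨k, l, hkl, hF⟩ := Finite.exists_ne_map_eq_of_infinite F
    rcases lt_or_gt_of_ne hkl with h | h
    exacts [⟨k, l, h, hF⟩, ⟨l, k, h, hF.symm⟩]
  have hF' : c k * (φ ^ k) g * (c k)⁻¹ = c l * (φ ^ l) g * (c l)⁻¹ := congrArg Subtype.val hF
  obtain ⟨d, rfl⟩ := Nat.exists_eq_add_of_lt hkl
  set e := (c k)⁻¹ * c (k + d + 1) with he
  have h1 : (φ ^ k) g = e * (φ ^ (k + d + 1)) g * e⁻¹ := by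
    rw [he]
    calc (φ ^ k) g = (c k)⁻¹ * (c k * (φ ^ k) g * (c k)⁻¹) * c k := by group
      _ = _ := by rw [hF']; group
  have h2 : φ⁻¹ g = (φ ^ (k + 1))⁻¹ e * (φ ^ d) g * ((φ ^ (k + 1))⁻¹ e)⁻¹ := by
    have h3 : φ⁻¹ g = (φ ^ (k + 1))⁻¹ ((φ ^ k) g) := by
      rw [← MulAut.mul_apply]
      congr 1
      rw [pow_succ]; group
    have h4 : (φ ^ d) g = (φ ^ (k + 1))⁻¹ ((φ ^ (k + d + 1)) g) := by
      rw [← MulAut.mul_apply]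
      congr 1
      rw [show k + d + 1 = (k + 1) + d by omega, pow_add]; group
    rw [h3, h1, map_mul, map_mul, map_inv, ← h4]
  rw [h2, cyclen_conj]
  exact hpow d

theorem lamA_inv_le_one_of_isHalfTreeLike (hN : 2 ≤ N) {φ : MulAut (FreeGroup (Fin N))}
    (h : ∀ y, ∃ β, IsHalfTreeLike φ y β) : lamA N (fun w => φ⁻¹ w) ≤ 1 := by
  refine lamA_le hN fun g => ?_
  rw [one_mul]
  exact_mod_cast (cyclen_inv_map_le (cyclen_map_le_of_isHalfTreeLike h) g).trans (cyclen_le_wlen g)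

/-! ### The upper bound for conjugacy lengths -/

theorem toWord_mul_letter (h : FreeGroup (Fin N)) (b : Fin N × Bool) :
    (h * mk [b]).toWord = h.toWord ++ [b] ∨
      h.toWord = (h * mk [b]).toWord ++ [(b.1, !b.2)] := by
  have hr : IsReduced h.toWord := isReduced_toWord
  by_cases hb : IsReduced (h.toWord ++ [b])
  · left
    conv_lhs => rw [← mk_toWord (x := h), mul_mk, toWord_mk_of_isReduced hb]
  · right
    rcases List.eq_nil_or_concat' h.toWord with h0 | ⟨t, a, hta⟩
    · simp [h0] at hb
    have hab : a = (b.1, !b.2) := by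
      by_contra hne
      refine hb ?_
      rw [hta] at hr ⊢
      refine hr.append_overlap ?_ (by simp)
      have : a.1 = b.1 → a.2 = b.2 := by
        intro h1
        by_contra h2
        exact hne (Prod.ext h1 (by cases h3 : a.2 <;> cases h4 : b.2 <;> simp_all))
      simpa [isReduced_cons_cons] using this
    have h1 : mk [b] = (mk [a])⁻¹ := by rw [inv_mk, hab]; simp [invRev]
    have h2 : h * mk [b] = mk t := by
      rw [← mk_toWord (x := h), hta, ← mul_mk, mul_assoc, h1, mul_inv_cancel, mul_one]
    rw [h2, toWord_mk_of_isReduced (hr.infix ⟨[], [a], by simp [hta]⟩), hta, hab]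

theorem posVar_letter_le (A : List (Fin N × Bool) → ℝ) (b : Fin N × Bool) :
    posVar (mk [b]) (fun h => A h.toWord) ≤
      2 * ∑' h : FreeGroup (Fin N), ENNReal.ofReal |A h.toWord - A h.toWord.dropLast| := by
  set d : FreeGroup (Fin N) → ℝ≥0∞ := fun h =>
    ENNReal.ofReal |A h.toWord - A h.toWord.dropLast| with hd
  have h1 : ∑' h, d (h * mk [b]) = ∑' h, d h := (Equiv.mulRight (mk [b])).tsum_eq d
  calc posVar (mk [b]) (fun h => A h.toWord) ≤ ∑' h, (d (h * mk [b]) + d h) := by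
        refine ENNReal.tsum_le_tsum fun h => ?_
        rcases toWord_mul_letter h b with h2 | h2
        · refine le_trans ?_ (self_le_add_right _ _)
          refine ENNReal.ofReal_le_ofReal ?_
          dsimp only
          rw [h2, List.dropLast_concat]
          exact le_abs_self _
        · refine le_trans ?_ (self_le_add_left _ _)
          refine ENNReal.ofReal_le_ofReal ?_
          dsimp only
          rw [h2, List.dropLast_concat, abs_sub_comm]
          exact le_abs_self _
    _ = 2 * ∑' h, d h := by rw [ENNReal.tsum_add, h1, two_mul]

theorem tsum_dropLast_le (A : List (Fin N × Bool) → ℝ) {m : ℕ}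
    (hA : ∀ L, A (L.take m) = A L) :
    ∑' h : FreeGroup (Fin N), ENNReal.ofReal |A h.toWord - A h.toWord.dropLast| =
      ENNReal.ofReal (∑ k ∈ Finset.range m, ∑ L ∈ sphere N (k + 1), |A L - A L.dropLast|) := by
  classical
  rw [tsum_eq_sum (s := ((Finset.range m).biUnion fun k => sphere N (k + 1)).image mk)]
  · rw [Finset.sum_image, Finset.sum_biUnion, ENNReal.ofReal_sum_of_nonneg]
    · refine Finset.sum_congr rfl fun k _ => ?_
      rw [ENNReal.ofReal_sum_of_nonneg fun _ _ => abs_nonneg _]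
      refine Finset.sum_congr rfl fun L hL => ?_
      rw [toWord_mk_of_isReduced (mem_sphere.1 hL).2]
    · exact fun _ _ => Finset.sum_nonneg fun _ _ => abs_nonneg _
    · intro k _ l _ hkl
      rw [Function.onFun, Finset.disjoint_left]
      intro L hL hL'
      have h1 := (mem_sphere.1 hL).1
      have h2 := (mem_sphere.1 hL').1
      omega
    · intro L hL L' hL' h
      obtain ⟨k, _, hk⟩ := Finset.mem_biUnion.1 hL
      obtain ⟨k', _, hk'⟩ := Finset.mem_biUnion.1 hL'
      rw [← toWord_mk_of_isReduced (mem_sphere.1 hk).2, h,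
        toWord_mk_of_isReduced (mem_sphere.1 hk').2]
  · intro h hh
    suffices A h.toWord = A h.toWord.dropLast by simp [this]
    by_cases h0 : h.toWord = []
    · simp [h0]
    have hpos := List.length_pos_iff.2 h0
    have hlt : m < h.toWord.length := by
      by_contra hle
      refine hh (Finset.mem_image.2 ⟨h.toWord, Finset.mem_biUnion.2 ⟨h.toWord.length - 1, ?_, ?_⟩,
        mk_toWord⟩)
      · rw [Finset.mem_range]; omega
      · exact mem_sphere.2 ⟨by omega, isReduced_toWord⟩
    rw [← hA h.toWord, ← hA h.toWord.dropLast, List.dropLast_eq_take, List.take_take,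
      min_eq_left (by omega)]

theorem abs_average_sub_average_le {ι : Type*} {s t : Finset ι} (f : ι → ℝ) (hs : s.Nonempty)
    (ht : t.Nonempty) :
    |(∑ x ∈ s, f x) / s.card - (∑ z ∈ t, f z) / t.card| ≤
      (∑ x ∈ s, ∑ z ∈ t, |f x - f z|) / (s.card * t.card) := by
  have hs0 : (0 : ℝ) < s.card := by exact_mod_cast hs.card_pos
  have ht0 : (0 : ℝ) < t.card := by exact_mod_cast ht.card_pos
  have h : (∑ x ∈ s, f x) / s.card - (∑ z ∈ t, f z) / t.card =
      (∑ x ∈ s, ∑ z ∈ t, (f x - f z)) / (s.card * t.card) := by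
    simp only [Finset.sum_sub_distrib, Finset.sum_const, nsmul_eq_mul]
    rw [← Finset.mul_sum]
    field_simp
  rw [h, abs_div, abs_of_pos (mul_pos hs0 ht0)]
  gcongr
  refine (Finset.abs_sum_le_sum_abs _ _).trans (Finset.sum_le_sum fun x _ => ?_)
  exact Finset.abs_sum_le_sum_abs _ _

open Classical in
/-- The average of the indicator of `U` over the points of the `m`-sphere extending `v`. -/
noncomputable def branchAverage (U : Set (FreeGroup (Fin N))) (m : ℕ)
    (v : List (Fin N × Bool)) : ℝ :=
  (∑ x ∈ (sphere N m).filter fun x => v <+: x, U.indicator 1 (mk x)) /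
    ((sphere N m).filter fun x => v <+: x).card

open Classical in
theorem card_filter_prefix_ge_real {v : List (Fin N × Bool)} (hN : 2 ≤ N) (hv : IsReduced v) {m : ℕ}
    (hm : v.length ≤ m) : ((2 * N - 1 : ℕ) : ℝ) ^ (m - v.length) ≤
      (((sphere N m).filter fun x => v <+: x).card : ℝ) := by
  by_cases hne : v = []
  · subst hne
    have h : (sphere N m).filter (fun x => [] <+: x) = sphere N m :=
      Finset.filter_true_of_mem fun x _ => List.nil_prefix
    rw [h]
    cases m with
    | zero => simpa using card_sphere_pos hN 0
    | succ m =>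
      rw [card_sphere_succ]
      have : (2 * N - 1) ^ (m + 1) ≤ 2 * N * (2 * N - 1) ^ m := by
        rw [pow_succ']; exact Nat.mul_le_mul_right _ (by omega)
      exact_mod_cast this
  · exact_mod_cast card_filter_prefix_ge hv hne hm

theorem branchAverage_of_length_eq (U : Set (FreeGroup (Fin N))) {m : ℕ}
    {v : List (Fin N × Bool)} (hv : IsReduced v) (hm : v.length = m) :
    branchAverage U m v = U.indicator 1 (mk v) := by
  classical
  have h : (sphere N m).filter (fun x => v <+: x) = {v} := by
    ext x
    rw [Finset.mem_filter, mem_sphere, Finset.mem_singleton]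
    constructor
    · rintro ⟨⟨h1, -⟩, h2⟩
      exact (h2.eq_of_length (hm.trans h1.symm)).symm
    · rintro rfl
      exact ⟨⟨hm, hv⟩, List.prefix_rfl⟩
  rw [branchAverage]
  convert div_one _ using 2
  · rw [h, Finset.card_singleton, Nat.cast_one]
  · rw [h, Finset.sum_singleton]

open Classical in
theorem abs_branchAverage_sub_le (hN : 2 ≤ N) (U : Set (FreeGroup (Fin N))) {m k : ℕ}
    (hk : k < m) {v : List (Fin N × Bool)} (hv : v ∈ sphere N (k + 1)) :
    |branchAverage U m v - branchAverage U m v.dropLast| ≤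
      ∑ x ∈ sphere N m, ∑ z ∈ sphere N m, if v <+: x ∧ v.dropLast <+: z then
        |U.indicator 1 (mk x) - U.indicator 1 (mk z)| *
          (((2 * N - 1 : ℕ) : ℝ) ^ (2 * k + 1) / ((2 * N - 1 : ℕ) : ℝ) ^ (2 * m)) else 0 := by
  obtain ⟨hl, hr⟩ := mem_sphere.1 hv
  have hr' : IsReduced v.dropLast := hr.infix (List.dropLast_prefix v).isInfix
  have hl' : v.dropLast.length = k := by simp [hl]
  have hq : (0 : ℝ) < ((2 * N - 1 : ℕ) : ℝ) := by exact_mod_cast (show 0 < 2 * N - 1 by omega)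
  have h1 := card_filter_prefix_ge_real hN hr (m := m) (by omega)
  have h2 := card_filter_prefix_ge_real hN hr' (m := m) (by omega)
  rw [hl] at h1
  rw [hl'] at h2
  have hn1 := Finset.card_pos.1 (by exact_mod_cast (by positivity : (0 : ℝ) < _).trans_le h1 :
    0 < ((sphere N m).filter fun x => v <+: x).card)
  have hn2 := Finset.card_pos.1 (by exact_mod_cast (by positivity : (0 : ℝ) < _).trans_le h2 :
    0 < ((sphere N m).filter fun x => v.dropLast <+: x).card)
  refine (abs_average_sub_average_le (fun x => U.indicator (1 : FreeGroup (Fin N) → ℝ) (mk x)) hn1 hn2).trans ?_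
  have hsum : ∑ x ∈ sphere N m, ∑ z ∈ sphere N m, (if v <+: x ∧ v.dropLast <+: z then
        |U.indicator 1 (mk x) - U.indicator 1 (mk z)| *
          (((2 * N - 1 : ℕ) : ℝ) ^ (2 * k + 1) / ((2 * N - 1 : ℕ) : ℝ) ^ (2 * m)) else 0) =
      (∑ x ∈ (sphere N m).filter fun x => v <+: x,
        ∑ z ∈ (sphere N m).filter fun x => v.dropLast <+: x,
          |U.indicator (1 : FreeGroup (Fin N) → ℝ) (mk x) - U.indicator 1 (mk z)|) *
          (((2 * N - 1 : ℕ) : ℝ) ^ (2 * k + 1) / ((2 * N - 1 : ℕ) : ℝ) ^ (2 * m)) := by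
    rw [Finset.sum_mul, Finset.sum_filter]
    refine Finset.sum_congr rfl fun x _ => ?_
    rw [Finset.sum_mul, Finset.sum_filter]
    split_ifs with hx
    · simp only [hx, true_and]
    · simp [hx]
  rw [hsum, div_eq_mul_inv]
  refine mul_le_mul_of_nonneg_left ?_ (Finset.sum_nonneg fun _ _ => Finset.sum_nonneg fun _ _ =>
    abs_nonneg _)
  rw [inv_eq_one_div, div_le_div_iff₀ (mul_pos (by exact_mod_cast hn1.card_pos)
    (by exact_mod_cast hn2.card_pos)) (by positivity), one_mul]
  have h3 := mul_le_mul h1 h2 (by positivity) (by positivity)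
  calc ((2 * N - 1 : ℕ) : ℝ) ^ (2 * m) = ((2 * N - 1 : ℕ) : ℝ) ^ (2 * k + 1) *
        (((2 * N - 1 : ℕ) : ℝ) ^ (m - (k + 1)) * ((2 * N - 1 : ℕ) : ℝ) ^ (m - k)) := by
        rw [← pow_add, ← pow_add]; congr 1; omega
    _ ≤ _ := mul_le_mul_of_nonneg_left h3 (by positivity)

open Classical in
theorem card_filter_prefix_le (x z : List (Fin N × Bool)) (k : ℕ) :
    ((sphere N (k + 1)).filter fun v => v <+: x ∧ v.dropLast <+: z).card ≤
      if k ≤ commonPrefix x z then 1 else 0 := by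
  split_ifs with h
  · rw [Finset.card_le_one]
    intro v hv v' hv'
    obtain ⟨hv, h1, -⟩ := Finset.mem_filter.1 hv
    obtain ⟨hv', h1', -⟩ := Finset.mem_filter.1 hv'
    rw [List.prefix_iff_eq_take.1 h1, List.prefix_iff_eq_take.1 h1', (mem_sphere.1 hv).1,
      (mem_sphere.1 hv').1]
  · rw [Nat.le_zero, Finset.card_eq_zero, Finset.filter_eq_empty_iff]
    rintro v hv ⟨h1, h2⟩
    refine h ?_
    have := le_commonPrefix ((List.dropLast_prefix v).trans h1) h2
    rwa [List.length_dropLast, (mem_sphere.1 hv).1] at this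

theorem sum_pow_le {q : ℝ} (hq : 2 ≤ q) (m c : ℕ) :
    ∑ k ∈ Finset.range m, (if k ≤ c then q ^ (2 * k + 1) else 0) ≤ 2 * q ^ (2 * c + 1) := by
  have h1 : ∀ c : ℕ, ∑ k ∈ Finset.range (c + 1), q ^ (2 * k + 1) ≤ 2 * q ^ (2 * c + 1) := by
    intro c
    induction c with
    | zero => simp; linarith
    | succ c ih =>
      rw [Finset.sum_range_succ]
      have h2 : q ^ (2 * (c + 1) + 1) = q ^ (2 * c + 1) * q ^ 2 := by ring
      have h3 : 0 < q ^ (2 * c + 1) := by positivity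
      rw [h2]
      nlinarith [mul_nonneg h3.le (by nlinarith : 0 ≤ q ^ 2 - 2)]
  refine le_trans ?_ (h1 c)
  rw [← Finset.sum_filter]
  refine Finset.sum_le_sum_of_subset_of_nonneg ?_ fun _ _ _ => by positivity
  intro k hk
  rw [Finset.mem_range]
  have := (Finset.mem_filter.1 hk).2
  omega

theorem commonPrefix_comm (x z : List (Fin N × Bool)) : commonPrefix x z = commonPrefix z x := by
  induction x generalizing z with
  | nil => cases z <;> rfl
  | cons a x ih =>
    cases z with
    | nil => rfl
    | cons b z =>
      simp only [commonPrefix, ih z]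
      by_cases h : a = b
      · simp [h]
      · rw [if_neg h, if_neg (Ne.symm h)]

theorem sum_abs_indicator_mul_energy (U : Set (FreeGroup (Fin N))) (m : ℕ) :
    ∑ x ∈ sphere N m, ∑ z ∈ sphere N m, |U.indicator (1 : FreeGroup (Fin N) → ℝ) (mk x) - U.indicator 1 (mk z)| *
      (((2 * N - 1 : ℕ) : ℝ) ^ (2 * commonPrefix x z + 1) / ((2 * N - 1 : ℕ) : ℝ) ^ (2 * m)) =
      2 * energy U m := by
  classical
  set F : List (Fin N × Bool) → List (Fin N × Bool) → ℝ := fun x z =>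
    ((2 * N - 1 : ℕ) : ℝ) ^ (2 * commonPrefix x z + 1) / ((2 * N - 1 : ℕ) : ℝ) ^ (2 * m) with hF
  have hE : energy U m = ∑ x ∈ sphere N m, ∑ z ∈ sphere N m,
      if mk x ∉ U ∧ mk z ∈ U then F x z else 0 := by
    rw [energy, pairs, Finset.sum_filter, Finset.sum_product]
  have hsymm : ∀ x z, F x z = F z x := fun x z => by simp only [hF, commonPrefix_comm x z]
  rw [hE, two_mul (Finset.sum _ _)]
  conv_rhs => arg 2; rw [Finset.sum_comm]
  rw [← Finset.sum_add_distrib]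
  refine Finset.sum_congr rfl fun x _ => ?_
  rw [← Finset.sum_add_distrib]
  refine Finset.sum_congr rfl fun z _ => ?_
  rw [hsymm z x]
  by_cases hx : mk x ∈ U <;> by_cases hz : mk z ∈ U <;> simp [hx, hz, F]

theorem sum_abs_branchAverage_sub_le (hN : 2 ≤ N) (U : Set (FreeGroup (Fin N))) (m : ℕ) :
    ∑ k ∈ Finset.range m, ∑ v ∈ sphere N (k + 1),
      |branchAverage U m v - branchAverage U m v.dropLast| ≤ 4 * energy U m := by
  classical
  have hq : (2 : ℝ) ≤ ((2 * N - 1 : ℕ) : ℝ) := by exact_mod_cast (show 2 ≤ 2 * N - 1 by omega)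
  set q := ((2 * N - 1 : ℕ) : ℝ) with hqdef
  set D : List (Fin N × Bool) → List (Fin N × Bool) → ℝ := fun x z =>
    |U.indicator 1 (mk x) - U.indicator 1 (mk z)| with hD
  have hD0 : ∀ x z, 0 ≤ D x z := fun x z => abs_nonneg _
  calc _ ≤ ∑ k ∈ Finset.range m, ∑ v ∈ sphere N (k + 1), ∑ x ∈ sphere N m, ∑ z ∈ sphere N m,
        (if v <+: x ∧ v.dropLast <+: z then D x z * (q ^ (2 * k + 1) / q ^ (2 * m)) else 0) :=
        Finset.sum_le_sum fun k hk => Finset.sum_le_sum fun v hv =>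
          abs_branchAverage_sub_le hN U (Finset.mem_range.1 hk) hv
    _ = ∑ x ∈ sphere N m, ∑ z ∈ sphere N m, ∑ k ∈ Finset.range m, ∑ v ∈ sphere N (k + 1),
        (if v <+: x ∧ v.dropLast <+: z then D x z * (q ^ (2 * k + 1) / q ^ (2 * m)) else 0) := by
        have : ∀ k, ∑ v ∈ sphere N (k + 1), ∑ x ∈ sphere N m, ∑ z ∈ sphere N m,
            (if v <+: x ∧ v.dropLast <+: z then D x z * (q ^ (2 * k + 1) / q ^ (2 * m)) else 0) =
            ∑ x ∈ sphere N m, ∑ z ∈ sphere N m, ∑ v ∈ sphere N (k + 1),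
            (if v <+: x ∧ v.dropLast <+: z then D x z * (q ^ (2 * k + 1) / q ^ (2 * m)) else 0) := by
          intro k
          rw [Finset.sum_comm]
          exact Finset.sum_congr rfl fun x _ => Finset.sum_comm
        simp only [this]
        rw [Finset.sum_comm]
        exact Finset.sum_congr rfl fun x _ => Finset.sum_comm
    _ ≤ ∑ x ∈ sphere N m, ∑ z ∈ sphere N m,
        D x z * (2 * (q ^ (2 * commonPrefix x z + 1) / q ^ (2 * m))) := by
        refine Finset.sum_le_sum fun x _ => Finset.sum_le_sum fun z _ => ?_
        calc _ ≤ ∑ k ∈ Finset.range m, D x z *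
              ((if k ≤ commonPrefix x z then q ^ (2 * k + 1) else 0) / q ^ (2 * m)) := by
              refine Finset.sum_le_sum fun k _ => ?_
              rw [← Finset.sum_filter, Finset.sum_const, nsmul_eq_mul]
              have h1 : ((((sphere N (k + 1)).filter fun v => v <+: x ∧ v.dropLast <+: z).card : ℕ)
                  : ℝ) ≤ if k ≤ commonPrefix x z then 1 else 0 := by
                exact_mod_cast card_filter_prefix_le x z k
              refine (mul_le_mul_of_nonneg_right h1
                (mul_nonneg (hD0 x z) (by positivity))).trans (le_of_eq ?_)
              split_ifs <;> simp
          _ = D x z * ((∑ k ∈ Finset.range m,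
              (if k ≤ commonPrefix x z then q ^ (2 * k + 1) else 0)) / q ^ (2 * m)) := by
              rw [Finset.sum_div, Finset.mul_sum]
          _ ≤ _ := by
              refine mul_le_mul_of_nonneg_left ?_ (hD0 x z)
              rw [← mul_div_assoc]
              gcongr
              exact sum_pow_le hq m _
    _ = 2 * ∑ x ∈ sphere N m, ∑ z ∈ sphere N m,
        D x z * (q ^ (2 * commonPrefix x z + 1) / q ^ (2 * m)) := by
        simp only [Finset.mul_sum]
        refine Finset.sum_congr rfl fun x _ => Finset.sum_congr rfl fun z _ => ?_
        ring
    _ = 4 * energy U m := by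
        rw [hD, hqdef, sum_abs_indicator_mul_energy]
        ring

theorem energy_nonneg (U : Set (FreeGroup (Fin N))) (m : ℕ) : 0 ≤ energy U m :=
  Finset.sum_nonneg fun _ _ => by positivity

/-- Conjugacy lengths grow at most by a uniform multiple of the stretching factor. -/
theorem cyclen_map_le_lamA (hN : 2 ≤ N) (φ : MulAut (FreeGroup (Fin N))) (g : FreeGroup (Fin N)) :
    (cyclen (φ g) : ℝ) ≤ 16 * N * lamA N (fun w => φ w) * wlen g := by
  choose m₀ hm₀ using exists_locConst_halfSet φ 1
  set m := ∑ y, m₀ y with hm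
  have hU : ∀ y, LocConst (halfSet φ 1 y) m := fun y => (hm₀ y).mono
    (Finset.single_le_sum (f := m₀) (fun _ _ => Nat.zero_le _) (Finset.mem_univ y))
  have hlam := sum_energy_le_lamA hN φ (fun _ => 1) hU
  set A : Fin N × Bool → List (Fin N × Bool) → ℝ := fun y L =>
    branchAverage (halfSet φ 1 y) m (L.take m) with hA
  have hAtake : ∀ y L, A y (L.take m) = A y L := fun y L => by
    simp only [hA, List.take_take, min_self]
  have hpos : ∀ y b, posVar (mk [b]) (fun h => A y h.toWord) ≤
      ENNReal.ofReal (8 * energy (halfSet φ 1 y) m) := by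
    intro y b
    refine (posVar_letter_le (A y) b).trans ?_
    rw [tsum_dropLast_le (A y) (hAtake y)]
    have h1 : ∑ k ∈ Finset.range m, ∑ L ∈ sphere N (k + 1), |A y L - A y L.dropLast| ≤
        4 * energy (halfSet φ 1 y) m := by
      refine le_trans (le_of_eq ?_) (sum_abs_branchAverage_sub_le hN (halfSet φ 1 y) m)
      refine Finset.sum_congr rfl fun k hk => Finset.sum_congr rfl fun L hL => ?_
      have hl := (mem_sphere.1 hL).1
      have hk' := Finset.mem_range.1 hk
      simp only [hA]
      rw [List.take_of_length_le (by omega),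
        List.take_of_length_le (by rw [List.length_dropLast]; omega)]
    calc _ ≤ 2 * ENNReal.ofReal (4 * energy (halfSet φ 1 y) m) := by gcongr
      _ = ENNReal.ofReal (8 * energy (halfSet φ 1 y) m) := by
        rw [show (8 : ℝ) * energy (halfSet φ 1 y) m = 2 * (4 * energy (halfSet φ 1 y) m) by ring,
          ENNReal.ofReal_mul (by norm_num) (p := 2)]
        simp
  have hu : ∀ y, ∑' h, ENNReal.ofReal |halfTree y (φ h) - A y h.toWord| ≠ ∞ := by
    intro y
    refine tsum_ne_top_of_eq (o := 1) (m := m) (u := fun h => halfTree y (φ h))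
      (v := fun h => A y h.toWord) fun k hk => ?_
    simp only [one_mul, hA]
    rw [branchAverage_of_length_eq _ (isReduced_toWord.infix (List.take_prefix _ _).isInfix)
      (by rw [List.length_take]; exact min_eq_left hk)]
    have h1 := hU y k.toWord isReduced_toWord hk
    rw [mk_toWord] at h1
    have h2 : (halfSet φ 1 y).indicator (1 : FreeGroup (Fin N) → ℝ) k =
        (halfSet φ 1 y).indicator 1 (mk (k.toWord.take m)) := by
      by_cases h3 : k ∈ halfSet φ 1 y
      · rw [Set.indicator_of_mem h3, Set.indicator_of_mem (h1.1 h3)]; rfl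
      · rw [Set.indicator_of_notMem h3, Set.indicator_of_notMem fun h => h3 (h1.2 h)]
    simp [← h2, indicator_halfSet]
  have h1 := cyclen_le_sum_posVar φ (fun y h => A y h.toWord) hu g.toWord
  rw [mk_toWord] at h1
  have h2 : ∀ y, (g.toWord.map fun b => posVar (mk [b]) (fun h => A y h.toWord)).sum ≤
      ENNReal.ofReal (8 * energy (halfSet φ 1 y) m * wlen g) := by
    intro y
    refine (List.sum_le_card_nsmul _ (ENNReal.ofReal (8 * energy (halfSet φ 1 y) m)) ?_).trans
      (le_of_eq ?_)
    · intro t ht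
      obtain ⟨b, _, rfl⟩ := List.mem_map.1 ht
      exact hpos y b
    · rw [List.length_map, nsmul_eq_mul, mul_comm, ENNReal.ofReal_mul (q := (wlen g : ℝ)) (by
        have := energy_nonneg (halfSet φ 1 y) m; positivity), ENNReal.ofReal_natCast]
      rfl
  have h3 := h1.trans (Finset.sum_le_sum fun y _ => h2 y)
  have hnn : ∀ y ∈ Finset.univ, 0 ≤ 8 * energy (halfSet φ 1 y) m * wlen g := fun y _ => by
    have := energy_nonneg (halfSet φ 1 y) m; positivity
  rw [← ENNReal.ofReal_sum_of_nonneg hnn, ← ENNReal.ofReal_natCast,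
    ENNReal.ofReal_le_ofReal_iff (Finset.sum_nonneg hnn)] at h3
  refine h3.trans ?_
  rw [← Finset.sum_mul, ← Finset.mul_sum]
  refine mul_le_mul_of_nonneg_right ?_ (Nat.cast_nonneg _)
  have hN0 : (0 : ℝ) < 2 * N := by have : (2 : ℝ) ≤ N := by exact_mod_cast hN
                                   linarith
  rw [div_le_iff₀ hN0] at hlam
  linarith

/-! ### Balancing an automorphism by conjugation -/

theorem cyclen_mk_of_isCyclicallyReduced {L : List (Fin N × Bool)} (hL : IsCyclicallyReduced L) :
    cyclen (mk L) = L.length := by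
  refine le_antisymm ((cyclen_le_wlen _).trans (wlen_mk_le L)) ?_
  obtain ⟨C, hC⟩ := exists_wlen_pow_le (mk L)
  have h1 : ∀ k, wlen (mk L ^ k) = k * L.length := fun k => by
    rw [pow_mk, wlen_mk (hL.flatten_replicate k).isReduced]
    simp
  have h2 := hC (C + 1)
  rw [h1] at h2
  by_contra h3
  have h4 : cyclen (mk L) + 1 ≤ L.length := by omega
  nlinarith [Nat.mul_le_mul_left (C + 1) h4]

theorem wlen_letter_conj_le_of_head {g : FreeGroup (Fin N)} {e : Fin N × Bool}
    (h : g.toWord.head? = some e) : wlen ((mk [e])⁻¹ * g * mk [e]) ≤ wlen g := by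
  obtain ⟨t, ht⟩ := List.head?_eq_some_iff.1 h
  have h1 : (mk [e])⁻¹ * g * mk [e] = mk (t ++ [e]) := by
    have h2 : mk (e :: t) = mk [e] * mk t := by rw [mul_mk]; rfl
    rw [← mk_toWord (x := g), ht, h2, inv_mul_cancel_left, mul_mk]
  rw [h1]
  refine (wlen_mk_le _).trans ?_
  simp [wlen, ht]

theorem wlen_letter_conj_le_of_getLast {g : FreeGroup (Fin N)} {e : Fin N × Bool}
    (h : g.toWord.getLast? = some (e.1, !e.2)) : wlen ((mk [e])⁻¹ * g * mk [e]) ≤ wlen g := by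
  obtain ⟨t, ht⟩ := List.getLast?_eq_some_iff.1 h
  have h0 : mk [e] = (mk [(e.1, !e.2)])⁻¹ := by rw [inv_mk]; simp [invRev]
  have h1 : (mk [e])⁻¹ * g * mk [e] = mk ((e.1, !e.2) :: t) := by
    rw [← mk_toWord (x := g), ht, h0, ← mul_mk, mul_assoc, mul_inv_cancel_right, inv_inv, mul_mk]
    rfl
  rw [h1]
  refine (wlen_mk_le _).trans ?_
  simp [wlen, ht]

theorem wlen_letter_conj_lt {g : FreeGroup (Fin N)} {e : Fin N × Bool}
    (h : g.toWord.head? = some e) (h' : g.toWord.getLast? = some (e.1, !e.2)) :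
    wlen ((mk [e])⁻¹ * g * mk [e]) < wlen g := by
  obtain ⟨t, ht⟩ := List.head?_eq_some_iff.1 h
  rcases List.eq_nil_or_concat' t with rfl | ⟨s, c, rfl⟩
  · rw [ht] at h'
    have := congrArg (Option.map Prod.snd) h'
    simp at this
  · have hc : c = (e.1, !e.2) := by
      rw [ht] at h'
      simpa [List.getLast?_cons] using h'
    have h0 : mk [c] = (mk [e])⁻¹ := by rw [inv_mk, hc]; simp [invRev]
    have h1 : (mk [e])⁻¹ * g * mk [e] = mk s := by
      have h2 : mk (e :: (s ++ [c])) = mk [e] * (mk s * mk [c]) := by rw [mul_mk, mul_mk]; rfl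
      rw [← mk_toWord (x := g), ht, h2, inv_mul_cancel_left, h0, inv_mul_cancel_right]
    rw [h1]
    refine (wlen_mk_le _).trans_lt ?_
    simp [wlen, ht]

theorem exists_conj_wlen_le {g : Fin N → FreeGroup (Fin N)} {K : ℕ} (h1 : ∀ i, cyclen (g i) ≤ K)
    (h2 : ∀ i j, cyclen (g i * g j) ≤ K) : ∃ h, ∀ i, wlen (h * g i * h⁻¹) ≤ K := by
  obtain ⟨h, hmin⟩ : ∃ h, ∀ k, ∑ i, wlen (h * g i * h⁻¹) ≤ ∑ i, wlen (k * g i * k⁻¹) := by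
    obtain ⟨h, hh⟩ := Nat.sInf_mem (Set.range_nonempty fun k : FreeGroup (Fin N) =>
      ∑ i, wlen (k * g i * k⁻¹))
    exact ⟨h, fun k => hh.le.trans (Nat.sInf_le ⟨k, rfl⟩)⟩
  refine ⟨h, fun i => ?_⟩
  set f : Fin N → FreeGroup (Fin N) := fun i => h * g i * h⁻¹ with hf
  change wlen (f i) ≤ K
  by_cases hcyc : IsCyclicallyReduced (f i).toWord
  · have h3 := cyclen_mk_of_isCyclicallyReduced hcyc
    rw [mk_toWord] at h3
    rw [wlen, ← h3, hf, cyclen_conj]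
    exact h1 i
  obtain ⟨e, he, he'⟩ : ∃ e, (f i).toWord.head? = some e ∧
      (f i).toWord.getLast? = some (e.1, !e.2) := by
    rw [isCyclicallyReduced_iff] at hcyc
    push Not at hcyc
    obtain ⟨a, ha, b, hb, hab, hab'⟩ := hcyc isReduced_toWord
    refine ⟨b, hb, ?_⟩
    rw [Option.mem_def.1 ha, Option.some.injEq]
    exact Prod.ext hab (by cases h3 : a.2 <;> cases h4 : b.2 <;> simp_all)
  obtain ⟨j, hj⟩ : ∃ j, wlen (f j) < wlen ((mk [e])⁻¹ * f j * mk [e]) := by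
    by_contra hcon
    push Not at hcon
    have h3 := Finset.sum_lt_sum (fun j _ => hcon j)
      ⟨i, Finset.mem_univ i, wlen_letter_conj_lt he he'⟩
    have h4 := hmin ((mk [e])⁻¹ * h)
    have h5 : ∀ j, (mk [e])⁻¹ * h * g j * ((mk [e])⁻¹ * h)⁻¹ = (mk [e])⁻¹ * f j * mk [e] := by
      intro j; simp only [hf]; group
    simp only [h5] at h4
    exact absurd h4 (not_le.2 h3)
  have hhead : (f j).toWord.head? ≠ some e := fun h3 =>
    absurd hj (not_lt.2 (wlen_letter_conj_le_of_head h3))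
  have hlast : (f j).toWord.getLast? ≠ some (e.1, !e.2) := fun h3 =>
    absurd hj (not_lt.2 (wlen_letter_conj_le_of_getLast h3))
  have hcyc' : IsCyclicallyReduced ((f i).toWord ++ (f j).toWord) := by
    rw [isCyclicallyReduced_iff]
    constructor
    · refine List.isChain_append.2 ⟨isReduced_toWord, isReduced_toWord, ?_⟩
      intro x hx y hy hxy
      rw [he', Option.mem_def, Option.some.injEq] at hx
      subst hx
      by_contra hne
      refine hhead ?_
      rw [Option.mem_def.1 hy, Option.some.injEq]
      exact Prod.ext hxy.symm (by cases h3 : e.2 <;> cases h4 : y.2 <;> simp_all)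
    · intro x hx y hy hxy
      rw [List.head?_append, he, Option.some_or, Option.mem_def, Option.some.injEq] at hy
      subst hy
      by_cases h0 : (f j).toWord = []
      · rw [toWord_eq_nil_iff] at h0
        rw [h0, mul_one, inv_mul_cancel] at hj
        exact absurd hj (lt_irrefl _)
      · rw [List.getLast?_append_of_ne_nil _ h0] at hx
        by_contra hne
        refine hlast ?_
        rw [Option.mem_def.1 hx, Option.some.injEq]
        exact Prod.ext hxy (by cases h3 : e.2 <;> cases h4 : x.2 <;> simp_all)
  have h3 := cyclen_mk_of_isCyclicallyReduced hcyc'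
  rw [← mul_mk, mk_toWord, mk_toWord, List.length_append] at h3
  have h4 : f i * f j = h * (g i * g j) * h⁻¹ := by simp only [hf]; group
  rw [h4, cyclen_conj] at h3
  have h5 := h2 i j
  rw [wlen]
  omega

theorem lamA_congr {φ ψ : FreeGroup (Fin N) → FreeGroup (Fin N)}
    (h : ∀ g, cyclen (φ g) = cyclen (ψ g)) : lamA N φ = lamA N ψ := by
  have : avg N φ = avg N ψ := by
    ext n; simp only [avg, h]
  rw [lamA, lamA, this]

/-- After composing with an inner automorphism, the images of the generators have length controlled
by the stretching factor. -/
theorem exists_balanced (hN : 2 ≤ N) (φ : MulAut (FreeGroup (Fin N))) :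
    ∃ ψ : MulAut (FreeGroup (Fin N)), lamA N (fun w => ψ⁻¹ w) = lamA N (fun w => φ⁻¹ w) ∧
      ∀ i, (wlen (ψ (of i)) : ℝ) ≤ 32 * N * lamA N (fun w => φ w) := by
  set B := 32 * N * lamA N (fun w => φ w) with hB
  have hlam := (lamA_gap hN φ).1
  have hB0 : 0 ≤ B := by positivity
  have hN0 : (0 : ℝ) ≤ N := by positivity
  have hof : ∀ i, wlen (of i : FreeGroup (Fin N)) ≤ 1 := fun i => wlen_mk_le [(i, true)]
  have h1 : ∀ g : FreeGroup (Fin N), wlen g ≤ 2 → cyclen (φ g) ≤ ⌊B⌋₊ := by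
    intro g hg
    refine Nat.le_floor ((cyclen_map_le_lamA hN φ g).trans ?_)
    have : (wlen g : ℝ) ≤ 2 := by exact_mod_cast hg
    have h2 : 0 ≤ 16 * N * lamA N (fun w => φ w) := by positivity
    nlinarith
  obtain ⟨h, hh⟩ := exists_conj_wlen_le (g := fun i => φ (of i)) (K := ⌊B⌋₊)
    (fun i => h1 _ ((hof i).trans (by omega)))
    (fun i j => by
      rw [← map_mul]
      exact h1 _ ((wlen_mul_le _ _).trans (Nat.add_le_add (hof i) (hof j))))
  refine ⟨MulAut.conj h * φ, lamA_congr fun g => ?_, fun i => ?_⟩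
  · rw [mul_inv_rev, MulAut.mul_apply, MulAut.conj_inv_apply, map_mul, map_mul, map_inv]
    simpa using cyclen_conj (φ⁻¹ g) (φ⁻¹ h⁻¹)
  · rw [MulAut.mul_apply, MulAut.conj_apply]
    exact (Nat.cast_le.2 (hh i)).trans (Nat.floor_le hB0)

/-! ### Generic representations into `SL₂` -/

section Rep

variable {R R' : Type*} [CommRing R] [CommRing R']

/-- The product of elementary matrices `U(p 1) L(p 0) U(p 2)`. -/
def genMat (p : Fin 3 → R) : Matrix.SpecialLinearGroup (Fin 2) R :=
  ⟨!![1 + p 1 * p 0, p 2 * (1 + p 1 * p 0) + p 1; p 0, 1 + p 2 * p 0], by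
    rw [Matrix.det_fin_two_of]; ring⟩

/-- The representation of the free group with generators acting by `genMat (p i)`. -/
def rep (p : Fin N → Fin 3 → R) : FreeGroup (Fin N) →* Matrix.SpecialLinearGroup (Fin 2) R :=
  FreeGroup.lift fun i => genMat (p i)

theorem rep_of (p : Fin N → Fin 3 → R) (i : Fin N) : rep p (of i) = genMat (p i) :=
  FreeGroup.lift_apply_of

theorem map_genMat (f : R →+* R') (p : Fin 3 → R) :
    Matrix.SpecialLinearGroup.map f (genMat p) = genMat fun k => f (p k) := by
  ext i j
  change f ((genMat p).1 i j) = _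
  fin_cases i <;> fin_cases j <;> simp [genMat]

theorem map_rep (f : R →+* R') (p : Fin N → Fin 3 → R) (w : FreeGroup (Fin N)) :
    Matrix.SpecialLinearGroup.map f (rep p w) = rep (fun i k => f (p i k)) w := by
  have : (Matrix.SpecialLinearGroup.map f).comp (rep p) = rep fun i k => f (p i k) := by
    ext1 i
    rw [MonoidHom.comp_apply, rep_of, rep_of, map_genMat]
  exact DFunLike.congr_fun this w

/-- The matrix of a letter. -/
theorem rep_letter (p : Fin N → Fin 3 → R) (e : Fin N × Bool) :
    (rep p (mk [e])).1 = if e.2 then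
      !![1 + p e.1 1 * p e.1 0, p e.1 2 * (1 + p e.1 1 * p e.1 0) + p e.1 1;
        p e.1 0, 1 + p e.1 2 * p e.1 0]
      else !![1 + p e.1 2 * p e.1 0, -(p e.1 2 * (1 + p e.1 1 * p e.1 0) + p e.1 1);
        -p e.1 0, 1 + p e.1 1 * p e.1 0] := by
  obtain ⟨i, b⟩ := e
  cases b
  · have : mk [(i, false)] = (of i)⁻¹ := by rw [of, inv_mk]; rfl
    rw [this, map_inv, rep_of, Matrix.SpecialLinearGroup.coe_inv, genMat, Matrix.adjugate_fin_two_of]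
    simp
  · exact congrArg Subtype.val (rep_of p i)

theorem rep_cons (p : Fin N → Fin 3 → R) (e : Fin N × Bool) (L : List (Fin N × Bool)) (j k : Fin 2) :
    (rep p (mk (e :: L))).1 j k = (rep p (mk [e])).1 j 0 * (rep p (mk L)).1 0 k +
      (rep p (mk [e])).1 j 1 * (rep p (mk L)).1 1 k := by
  have : mk (e :: L) = mk [e] * mk L := by rw [mul_mk]; rfl
  rw [this, map_mul, Matrix.SpecialLinearGroup.coe_mul, Matrix.mul_apply, Fin.sum_univ_two]

/-- The elementary parameters of a matrix in `SL₂` with nonzero lower left entry. -/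
def params {F : Type*} [Field F] (M : Matrix.SpecialLinearGroup (Fin 2) F) : Fin 3 → F :=
  ![M.1 1 0, (M.1 0 0 - 1) / M.1 1 0, (M.1 1 1 - 1) / M.1 1 0]

theorem genMat_params {F : Type*} [Field F] {M : Matrix.SpecialLinearGroup (Fin 2) F}
    (h : M.1 1 0 ≠ 0) : genMat (params M) = M := by
  have hdet := M.2
  rw [Matrix.det_fin_two] at hdet
  ext i j
  fin_cases i <;> fin_cases j <;> simp [genMat, params] <;> field_simp
  · ring
  · linear_combination hdet
  · ring

end Rep

section Degree

open MvPolynomial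

theorem totalDegree_rep_le (L : List (Fin N × Bool)) (j k : Fin 2) :
    ((rep (fun i k => (X (i, k) : MvPolynomial (Fin N × Fin 3) ℚ)) (mk L)).1 j k).totalDegree ≤
      3 * L.length := by
  induction L generalizing j k with
  | nil =>
    rw [← FreeGroup.one_eq_mk, map_one, Matrix.SpecialLinearGroup.coe_one, Matrix.one_apply]
    split_ifs <;> simp
  | cons e L ih =>
    have hX : ∀ v, (X v : MvPolynomial (Fin N × Fin 3) ℚ).totalDegree ≤ 1 := fun v =>
      (totalDegree_X v).le
    have h2 : ∀ u v, (1 + X u * X v : MvPolynomial (Fin N × Fin 3) ℚ).totalDegree ≤ 2 := fun u v =>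
      (totalDegree_add _ _).trans (max_le (by simp)
        ((totalDegree_mul _ _).trans (Nat.add_le_add (hX u) (hX v))))
    have h3 : ∀ u v w z, (X w * (1 + X u * X v) + X z :
        MvPolynomial (Fin N × Fin 3) ℚ).totalDegree ≤ 3 := fun u v w z =>
      (totalDegree_add _ _).trans (max_le
        ((totalDegree_mul _ _).trans (Nat.add_le_add (hX w) (h2 u v))) ((hX z).trans (by omega)))
    have hletter : ∀ j k, ((rep (fun i k => (X (i, k) : MvPolynomial (Fin N × Fin 3) ℚ))
        (mk [e])).1 j k).totalDegree ≤ 3 := by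
      intro j k
      rw [rep_letter]
      split_ifs <;> fin_cases j <;> fin_cases k
      · exact (h2 _ _).trans (by omega)
      · exact h3 _ _ _ _
      · exact (hX _).trans (by omega)
      · exact (h2 _ _).trans (by omega)
      · exact (h2 _ _).trans (by omega)
      · exact (totalDegree_neg _).trans_le (h3 _ _ _ _)
      · exact (totalDegree_neg _).trans_le ((hX _).trans (by omega))
      · exact (h2 _ _).trans (by omega)
    rw [rep_cons]
    refine (totalDegree_add _ _).trans (max_le ?_ ?_) <;>
    · refine (totalDegree_mul _ _).trans ((Nat.add_le_add (hletter _ _) (ih _ _)).trans ?_)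
      rw [List.length_cons]; omega

/-- The generic parameters, with the lower triangular ones scaled by the degree variable. -/
noncomputable def scaledParams (N : ℕ) (i : Fin N) :
    Fin 3 → Polynomial (MvPolynomial (Fin N × Fin 3) ℚ) :=
  ![Polynomial.C (X (i, 0)) * Polynomial.X, Polynomial.C (X (i, 1)), Polynomial.C (X (i, 2))]

/-- The column direction of the leading coefficient of the matrix of a letter. -/
noncomputable def dir (e : Fin N × Bool) : Fin 2 → MvPolynomial (Fin N × Fin 3) ℚ :=
  if e.2 then ![X (e.1, 1), 1] else ![X (e.1, 2), -1]

/-- The row direction of the leading coefficient of the matrix of a letter. -/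
noncomputable def codir (e : Fin N × Bool) : Fin 2 → MvPolynomial (Fin N × Fin 3) ℚ :=
  if e.2 then ![1, X (e.1, 2)] else ![1, -X (e.1, 1)]

theorem codir_dotProduct_dir_ne_zero {e f : Fin N × Bool} (h : e.1 = f.1 → e.2 = f.2) :
    codir e 0 * dir f 0 + codir e 1 * dir f 1 ≠ 0 := by
  have hadd : ∀ u v : Fin N × Fin 3, (X u + X v : MvPolynomial (Fin N × Fin 3) ℚ) ≠ 0 := by
    intro u v h0
    have := congrArg (eval fun _ => (1 : ℚ)) h0
    norm_num at this
  have hsub : ∀ u v : Fin N × Fin 3, u ≠ v → (X u - X v : MvPolynomial (Fin N × Fin 3) ℚ) ≠ 0 :=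
    fun u v huv h0 => huv (X_injective (sub_eq_zero.1 h0))
  obtain ⟨i, b⟩ := e
  obtain ⟨j, c⟩ := f
  cases b <;> cases c <;> simp only [codir, dir] <;> simp at h ⊢
  · exact hadd _ _
  · rw [← sub_eq_add_neg]
    exact hsub _ _ fun h0 => h (congrArg Prod.fst h0).symm
  · rw [← sub_eq_add_neg]
    exact hsub _ _ fun h0 => h (congrArg Prod.fst h0).symm
  · exact hadd _ _

theorem rep_scaledParams_letter (e : Fin N × Bool) (j k : Fin 2) :
    ∃ r : MvPolynomial (Fin N × Fin 3) ℚ, (rep (scaledParams N) (mk [e])).1 j k =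
      Polynomial.C r + Polynomial.C (X (e.1, 0) * dir e j * codir e k) * Polynomial.X := by
  rw [rep_letter]
  obtain ⟨i, b⟩ := e
  cases b <;> fin_cases j <;> fin_cases k <;>
    simp only [codir, dir, scaledParams] <;> simp
  · exact ⟨1, by simp; ring⟩
  · exact ⟨-(X (i, 2) + X (i, 1)), by simp; ring⟩
  · exact ⟨0, by simp; ring⟩
  · exact ⟨1, by simp; ring⟩
  · exact ⟨1, by simp; ring⟩
  · exact ⟨X (i, 2) + X (i, 1), by simp; ring⟩
  · exact ⟨1, by simp; ring⟩

/-- The first column of the matrix of a reduced word has degree equal to the length of the word. -/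
theorem rep_scaledParams_leading (L : List (Fin N × Bool)) (e : Fin N × Bool)
    (hL : IsReduced (e :: L)) : ∃ c : MvPolynomial (Fin N × Fin 3) ℚ, c ≠ 0 ∧ ∀ j,
      ((rep (scaledParams N) (mk (e :: L))).1 j 0).natDegree ≤ L.length + 1 ∧
      ((rep (scaledParams N) (mk (e :: L))).1 j 0).coeff (L.length + 1) = c * dir e j := by
  induction L generalizing e with
  | nil =>
    refine ⟨X (e.1, 0), X_ne_zero _, fun j => ?_⟩
    have hc : codir e 0 = 1 := by rw [codir]; split_ifs <;> simp
    obtain ⟨r, hr⟩ := rep_scaledParams_letter e j 0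
    rw [hr, hc]
    constructor
    · simp only [List.length_nil]; compute_degree
    · simp
  | cons f L ih =>
    rw [FreeGroup.IsReduced, List.isChain_cons_cons] at hL
    obtain ⟨c, hc, hj⟩ := ih f hL.2
    refine ⟨X (e.1, 0) * (codir e 0 * dir f 0 + codir e 1 * dir f 1) * c, mul_ne_zero (mul_ne_zero
      (X_ne_zero _) (codir_dotProduct_dir_ne_zero hL.1)) hc, fun j => ?_⟩
    obtain ⟨r, hr⟩ := rep_scaledParams_letter e j 0
    obtain ⟨s, hs⟩ := rep_scaledParams_letter e j 1
    have hdeg : ∀ a b : MvPolynomial (Fin N × Fin 3) ℚ,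
        (Polynomial.C a + Polynomial.C b * Polynomial.X).natDegree ≤ 1 := fun a b => by
      compute_degree
    rw [rep_cons, hr, hs, List.length_cons]
    constructor
    · refine Polynomial.natDegree_add_le_of_degree_le ?_ ?_
      · exact Polynomial.natDegree_mul_le.trans
          ((Nat.add_le_add (hdeg _ _) (hj 0).1).trans (by omega))
      · exact Polynomial.natDegree_mul_le.trans
          ((Nat.add_le_add (hdeg _ _) (hj 1).1).trans (by omega))
    · have hz : ∀ k, ((rep (scaledParams N) (mk (f :: L))).1 k 0).coeff (L.length + 1 + 1) = 0 :=
        fun k => Polynomial.coeff_eq_zero_of_natDegree_lt (Nat.lt_succ_of_le (hj k).1)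
      simp only [add_mul, mul_assoc, Polynomial.coeff_add, Polynomial.coeff_C_mul,
        Polynomial.coeff_X_mul, hz, (hj _).2]
      ring

theorem natDegree_rep_scaledParams (w : FreeGroup (Fin N)) (hw : w ≠ 1) :
    ((rep (scaledParams N) w).1 1 0).natDegree = wlen w ∧ (rep (scaledParams N) w).1 1 0 ≠ 0 := by
  obtain ⟨e, L, hL⟩ := List.exists_cons_of_ne_nil (mt toWord_eq_nil_iff.1 hw)
  obtain ⟨c, hc, hj⟩ := rep_scaledParams_leading L e (hL ▸ isReduced_toWord)
  have hd : c * dir e 1 ≠ 0 := mul_ne_zero hc (by rw [dir]; split_ifs <;> simp)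
  have h1 := hj 1
  rw [← hL, mk_toWord] at h1
  have hcoeff : ((rep (scaledParams N) w).1 1 0).coeff (L.length + 1) ≠ 0 := h1.2 ▸ hd
  refine ⟨?_, fun h0 => hcoeff (by rw [h0, Polynomial.coeff_zero])⟩
  rw [wlen, hL]
  exact le_antisymm h1.1 (Polynomial.le_natDegree_of_ne_zero hcoeff)

end Degree

/-! ### A polynomial bound for the inverse of an automorphism -/

section Relation

open MvPolynomial

variable {ι : Type*} [Fintype ι] [DecidableEq ι]

theorem exists_bounded_relation (f : ι → MvPolynomial ι ℚ) (x : MvPolynomial ι ℚ) {d : ℕ}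
    (hd : 1 ≤ d) (hf : ∀ v, (f v).totalDegree ≤ d) (hx : x.totalDegree ≤ d) {n : ℕ}
    (hn : n = ((Fintype.card ι + 1) * d) ^ Fintype.card ι) :
    ∃ c : Fin (n + 1) × (ι → Fin (n + 1)) → ℚ, c ≠ 0 ∧
      ∑ a, c a • (x ^ (a.1 : ℕ) * ∏ v, f v ^ (a.2 v : ℕ)) = 0 := by
  set m := Fintype.card ι
  set E := (m + 1) * d * n with hE
  let T : (Fin (n + 1) × (ι → Fin (n + 1)) → ℚ) →ₗ[ℚ] ((ι → Fin (E + 1)) → ℚ) :=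
    LinearMap.pi (fun b => lcoeff ℚ (Finsupp.equivFunOnFinite.symm fun v => (b v : ℕ))) ∘ₗ
      Fintype.linearCombination ℚ (fun a => x ^ (a.1 : ℕ) * ∏ v, f v ^ (a.2 v : ℕ))
  have hker : LinearMap.ker T ≠ ⊥ := by
    apply LinearMap.ker_ne_bot_of_finrank_lt
    simp only [Module.finrank_fintype_fun_eq_card, Fintype.card_prod, Fintype.card_fun,
      Fintype.card_fin]
    have h1 : E + 1 ≤ (m + 1) * d * (n + 1) := by
      have : 1 ≤ (m + 1) * d := Nat.mul_pos (by omega) hd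
      rw [hE]; nlinarith
    calc (E + 1) ^ m ≤ ((m + 1) * d * (n + 1)) ^ m := Nat.pow_le_pow_left h1 m
      _ = n * (n + 1) ^ m := by rw [mul_pow, hn]
      _ < (n + 1) * (n + 1) ^ m := Nat.mul_lt_mul_of_pos_right (by omega) (by positivity)
  obtain ⟨c, hc, hc0⟩ := Submodule.exists_mem_ne_zero_of_ne_bot hker
  refine ⟨c, hc0, ?_⟩
  have hterm : ∀ a : Fin (n + 1) × (ι → Fin (n + 1)),
      (x ^ (a.1 : ℕ) * ∏ v, f v ^ (a.2 v : ℕ)).totalDegree ≤ E := by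
    intro a
    have hpow : ∀ (g : MvPolynomial ι ℚ) (k : Fin (n + 1)), g.totalDegree ≤ d →
        (g ^ (k : ℕ)).totalDegree ≤ n * d := fun g k hg =>
      (totalDegree_pow _ _).trans (Nat.mul_le_mul (by omega) hg)
    refine (totalDegree_mul _ _).trans ((Nat.add_le_add (hpow _ _ hx)
      ((totalDegree_finsetProd _ _).trans (Finset.sum_le_sum fun v _ => hpow _ _ (hf v)))).trans ?_)
    rw [Finset.sum_const, Finset.card_univ, smul_eq_mul, hE]
    exact le_of_eq (by ring)
  have hdeg : (∑ a, c a • (x ^ (a.1 : ℕ) * ∏ v, f v ^ (a.2 v : ℕ))).totalDegree ≤ E :=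
    totalDegree_finsetSum_le fun a _ => (totalDegree_smul_le _ _).trans (hterm a)
  ext s
  rw [coeff_zero]
  by_contra hs
  have hsE : ∀ v, s v ≤ E := fun v => by
    refine le_trans ?_ ((le_totalDegree (mem_support_iff.2 hs)).trans hdeg)
    by_cases hv : v ∈ s.support
    · exact Finset.single_le_sum (f := fun v => s v) (fun _ _ => Nat.zero_le _) hv
    · rw [Finsupp.notMem_support_iff.1 hv]; exact Nat.zero_le _
  have h0 := congrFun (LinearMap.mem_ker.1 hc) fun v => ⟨s v, Nat.lt_succ_of_le (hsE v)⟩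
  apply hs
  have hs' : (Finsupp.equivFunOnFinite.symm fun v => s v) = s := by ext; simp
  simpa [T, Fintype.linearCombination_apply, hs', coeff_sum] using h0

end Relation

theorem eq_zero_of_sum_mul_pow_eq_zero {S : Type*} [CommRing S] [IsDomain S] {z : Polynomial S}
    {M : ℕ} (hz : M < z.natDegree) {n : ℕ} (P : Fin n → Polynomial S)
    (hP : ∀ k, (P k).natDegree ≤ M) (h : ∑ k, P k * z ^ (k : ℕ) = 0) : ∀ k, P k = 0 := by
  induction n with
  | zero => exact fun k => k.elim0
  | succ n ih =>
    have hz0 : z ≠ 0 := by rintro rfl; simp at hz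
    have h1 : P 0 + z * ∑ k : Fin n, P k.succ * z ^ (k : ℕ) = 0 := by
      rw [← h, Fin.sum_univ_succ, Finset.mul_sum]
      congr 1
      · simp
      · exact Finset.sum_congr rfl fun k _ => by rw [Fin.val_succ, pow_succ]; ring
    have h2 : P 0 = 0 := by
      refine Polynomial.eq_zero_of_dvd_of_natDegree_lt (p := z) ?_ ((hP 0).trans_lt hz)
      exact ⟨-∑ k : Fin n, P k.succ * z ^ (k : ℕ), by linear_combination h1⟩
    rw [h2, zero_add] at h1
    have h3 := ih (fun k => P k.succ) (fun k => hP _) ((mul_eq_zero.1 h1).resolve_left hz0)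
    exact Fin.cases h2 h3

section Inverse

open MvPolynomial

/-- The three matrix entries which determine an element of `SL₂` with nonzero lower left entry. -/
def coords {R : Type*} [CommRing R] (M : Matrix.SpecialLinearGroup (Fin 2) R) : Fin 3 → R :=
  ![M.1 1 0, M.1 0 0, M.1 1 1]

theorem coords_map {R R' : Type*} [CommRing R] [CommRing R'] (f : R →+* R')
    (M : Matrix.SpecialLinearGroup (Fin 2) R) (k : Fin 3) :
    coords (Matrix.SpecialLinearGroup.map f M) k = f (coords M k) := by
  fin_cases k <;> rfl

theorem coords_scaledParams_independent {n : ℕ} (c : (Fin N × Fin 3 → Fin n) → ℚ)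
    (h : ∑ a, c a • ∏ v, coords (genMat (scaledParams N v.1)) v.2 ^ (a v : ℕ) = 0) : c = 0 := by
  classical
  let F := FractionRing (MvPolynomial (Fin N × Fin 3) ℚ)
  let x : Fin N × Fin 3 → F := fun v => algebraMap (MvPolynomial (Fin N × Fin 3) ℚ) F (X v)
  have hx : ∀ v, x v ≠ 0 := fun v => by
    simp only [x]
    rw [Ne, FaithfulSMul.algebraMap_eq_zero_iff]
    exact X_ne_zero v
  let θ : Polynomial (MvPolynomial (Fin N × Fin 3) ℚ) →+* F := Polynomial.eval₂RingHom
    (aeval (fun v : Fin N × Fin 3 =>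
      (![x (v.1, 0), (x (v.1, 1) - 1) / x (v.1, 0), (x (v.1, 2) - 1) / x (v.1, 0)] : Fin 3 → F)
        v.2)).toRingHom 1
  have hθ : ∀ v : Fin N × Fin 3, θ (coords (genMat (scaledParams N v.1)) v.2) = x v := by
    rintro ⟨i, k⟩
    have := hx (i, 0)
    fin_cases k <;> simp [coords, genMat, scaledParams, θ] <;>
      rw [div_mul_cancel₀ _ this, add_sub_cancel]
  have h1 := congrArg θ h
  simp only [map_sum, map_prod, map_pow, map_zero, map_rat_smul, hθ] at h1
  have h2 : ∑ a, c a • ∏ v, (X v : MvPolynomial (Fin N × Fin 3) ℚ) ^ (a v : ℕ) = 0 := by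
    apply FaithfulSMul.algebraMap_injective (MvPolynomial (Fin N × Fin 3) ℚ) F
    simpa only [map_sum, map_prod, map_pow, map_zero, map_rat_smul, x] using h1
  have hmon : ∀ a : Fin N × Fin 3 → Fin n, ∏ v, (X v : MvPolynomial (Fin N × Fin 3) ℚ) ^ (a v : ℕ) =
      monomial (Finsupp.equivFunOnFinite.symm fun v => (a v : ℕ)) 1 := fun a => by
    rw [monomial_eq, Finsupp.prod_fintype _ _ (fun _ => pow_zero _)]
    simp
  ext a
  have h3 := congrArg (coeff (Finsupp.equivFunOnFinite.symm fun v => (a v : ℕ))) h2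
  simp only [hmon, coeff_sum, coeff_smul, coeff_monomial, EmbeddingLike.apply_eq_iff_eq] at h3
  have h4 : ∀ b : Fin N × Fin 3 → Fin n,
      ((fun v => (b v : ℕ)) = fun v => (a v : ℕ)) ↔ b = a := fun b =>
    ⟨fun h => funext fun v => Fin.ext (congrFun h v), fun h => by rw [h]⟩
  simpa [h4] using h3

theorem natDegree_coords_scaledParams (i : Fin N) (k : Fin 3) :
    (coords (genMat (scaledParams N i)) k).natDegree ≤ 1 := by
  fin_cases k <;> simp only [coords, genMat, scaledParams] <;> simp <;> compute_degree

/-- The lengths of the images of the generators under the inverse of an automorphism are bounded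
polynomially by the lengths of the images of the generators under the automorphism. -/
theorem wlen_inv_le (φ : MulAut (FreeGroup (Fin N))) {l : ℕ} (hl : 1 ≤ l)
    (hφ : ∀ j, wlen (φ (of j)) ≤ l) (i : Fin N) :
    wlen (φ⁻¹ (of i)) ≤ 3 * N * ((3 * N + 1) * (3 * l)) ^ (3 * N) := by
  set n := ((3 * N + 1) * (3 * l)) ^ (3 * N) with hn
  have hcard : Fintype.card (Fin N × Fin 3) = 3 * N := by simp [mul_comm]
  let S := MvPolynomial (Fin N × Fin 3) ℚ
  let F := FractionRing (Polynomial S)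
  let gX : Fin N → Fin 3 → S := fun i k => X (i, k)
  let ι : Polynomial S →+* F := algebraMap _ F
  have hι : Function.Injective ι := FaithfulSMul.algebraMap_injective _ F
  let B : Fin N → Matrix.SpecialLinearGroup (Fin 2) (Polynomial S) := fun j =>
    rep (scaledParams N) (φ⁻¹ (of j))
  have hne : ∀ j, φ⁻¹ (of j) ≠ 1 := fun j h => of_ne_one j ((map_eq_one_iff φ⁻¹ φ⁻¹.injective).1 h)
  have hB : ∀ j, ι ((B j).1 1 0) ≠ 0 := fun j =>
    (map_ne_zero_iff ι hι).2 (natDegree_rep_scaledParams _ (hne j)).2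
  let b : Fin N → Fin 3 → F := fun j => params (Matrix.SpecialLinearGroup.map ι (B j))
  let θ : S →+* F := (aeval fun v : Fin N × Fin 3 => b v.1 v.2).toRingHom
  have hθX : ∀ j k, θ (gX j k) = b j k := fun j k =>
    aeval_X (fun v : Fin N × Fin 3 => b v.1 v.2) (j, k)
  have hrep : ∀ w, rep b w = Matrix.SpecialLinearGroup.map ι (rep (scaledParams N) (φ⁻¹ w)) := by
    have : rep b = ((Matrix.SpecialLinearGroup.map ι).comp (rep (scaledParams N))).comp
        (φ⁻¹).toMonoidHom := by
      ext1 j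
      rw [rep_of]
      exact genMat_params (hB j)
    exact fun w => DFunLike.congr_fun this w
  let f : Fin N × Fin 3 → S := fun v => coords (rep gX (φ (of v.1))) v.2
  have hf : ∀ v, θ (f v) = ι (coords (genMat (scaledParams N v.1)) v.2) := fun v => by
    rw [← coords_map, ← coords_map, map_rep]
    simp only [hθX]
    rw [hrep, MulAut.inv_apply_self, rep_of]
  have hfdeg : ∀ v, (f v).totalDegree ≤ 3 * l := fun v => by
    have h1 : ∀ j k, ((rep gX (φ (of v.1))).1 j k).totalDegree ≤ 3 * l := fun j k => by
      have := totalDegree_rep_le (φ (of v.1)).toWord j k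
      rw [mk_toWord] at this
      exact this.trans (Nat.mul_le_mul_left 3 (hφ v.1))
    obtain ⟨j, k⟩ := v
    fin_cases k <;> exact h1 _ _
  obtain ⟨c, hc0, hc⟩ := exists_bounded_relation f (X (i, 0)) (d := 3 * l) (by omega) hfdeg
    ((totalDegree_X _).trans_le (by omega)) (n := n) (by rw [hcard])
  have hθi : θ (X (i, 0)) = ι ((B i).1 1 0) := hθX i 0
  have h1 := congrArg θ hc
  simp only [map_sum, map_mul, map_prod, map_pow, map_zero, map_rat_smul, hf, hθi] at h1
  let P : Fin (n + 1) → Polynomial S := fun k =>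
    ∑ a, c (k, a) • ∏ v, coords (genMat (scaledParams N v.1)) v.2 ^ (a v : ℕ)
  have h2 : ∑ k, P k * (B i).1 1 0 ^ (k : ℕ) = 0 := by
    apply hι
    rw [map_zero, ← h1, Fintype.sum_prod_type]
    simp only [P, map_sum, map_mul, map_prod, map_pow, map_rat_smul, Finset.sum_mul]
    refine Finset.sum_congr rfl fun k _ => Finset.sum_congr rfl fun a _ => ?_
    rw [smul_mul_assoc, mul_comm]
  rw [← (natDegree_rep_scaledParams _ (hne i)).1]
  by_contra hlt
  push Not at hlt
  have hP : ∀ k, (P k).natDegree ≤ 3 * N * n := fun k => by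
    refine Polynomial.natDegree_sum_le_of_forall_le _ _ fun a _ => ?_
    refine (Polynomial.natDegree_smul_le _ _).trans ((Polynomial.natDegree_prod_le _ _).trans ?_)
    rw [← hcard, ← smul_eq_mul, ← Finset.card_univ]
    refine Finset.sum_le_card_nsmul _ _ _ fun v _ => ?_
    refine Polynomial.natDegree_pow_le.trans ?_
    calc (a v : ℕ) * _ ≤ n * 1 :=
        Nat.mul_le_mul (by omega) (natDegree_coords_scaledParams v.1 v.2)
      _ = n := mul_one n
  have h3 := eq_zero_of_sum_mul_pow_eq_zero hlt P hP h2
  apply hc0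
  ext ⟨k, a⟩
  exact congrFun (coords_scaledParams_independent (fun a => c (k, a)) (h3 k)) a

end Inverse

/-! ### Comparison of stretching factors -/

theorem exists_lamA_inv_le_pow (hN : 2 ≤ N) : ∃ C : ℝ, 1 ≤ C ∧ ∀ φ : MulAut (FreeGroup (Fin N)),
    lamA N (fun w => φ⁻¹ w) ≤ C * lamA N (fun w => φ w) ^ (3 * N) := by
  have hN1 : (2 : ℝ) ≤ N := by exact_mod_cast hN
  refine ⟨3 * N * ((3 * N + 1) * (3 * (32 * N))) ^ (3 * N), ?_, fun φ => ?_⟩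
  · have h1 : (1 : ℝ) ≤ (3 * N + 1) * (3 * (32 * N)) := by nlinarith
    have h2 := one_le_pow₀ h1 (n := 3 * N)
    nlinarith
  · obtain ⟨ψ, hψ, hlen⟩ := exists_balanced hN φ
    have hlam := (lamA_gap hN φ).1
    set lam := lamA N (fun w => φ w)
    set l := ⌊32 * N * lam⌋₊
    have hl : 1 ≤ l := Nat.le_floor (by push_cast; nlinarith)
    have hl' : (l : ℝ) ≤ 32 * N * lam := Nat.floor_le (by positivity)
    have h1 := wlen_inv_le ψ hl fun j => Nat.le_floor (hlen j)
    rw [← hψ]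
    refine (lamA_le hN (K := ((3 * N * ((3 * N + 1) * (3 * l)) ^ (3 * N) : ℕ) : ℝ)) fun g => ?_).trans
      ?_
    · exact_mod_cast (cyclen_le_wlen _).trans (wlen_map_le (ψ⁻¹).toMonoidHom h1 g)
    · push_cast
      calc (3 * N * ((3 * N + 1) * (3 * l)) ^ (3 * N) : ℝ)
          ≤ 3 * N * ((3 * N + 1) * (3 * (32 * N * lam))) ^ (3 * N) := by gcongr
        _ = _ := by rw [mul_assoc (3 * (N : ℝ)), ← mul_pow]; ring

theorem exists_log_lamA_inv_le (hN : 2 ≤ N) : ∃ D : ℝ, 1 ≤ D ∧ ∀ φ : MulAut (FreeGroup (Fin N)),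
    Real.log (lamA N (fun w => φ⁻¹ w)) ≤ D * Real.log (lamA N (fun w => φ w)) := by
  obtain ⟨C, hC, hpow⟩ := exists_lamA_inv_le_pow hN
  set δ : ℝ := 1 + 1 / (2 * ((2 * N - 1 : ℕ) : ℝ)) / (2 * N) with hδ
  have hδ1 : 1 < δ := by
    have : (0 : ℝ) < ((2 * N - 1 : ℕ) : ℝ) := by exact_mod_cast (by omega : 0 < 2 * N - 1)
    have h2 : (0 : ℝ) < N := by exact_mod_cast (by omega : 0 < N)
    rw [hδ]
    exact lt_add_of_pos_right 1 (by positivity)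
  have hlog : 0 < Real.log δ := Real.log_pos hδ1
  have hlogC : 0 ≤ Real.log C := Real.log_nonneg hC
  have hNr : (2 : ℝ) ≤ N := by exact_mod_cast hN
  refine ⟨Real.log C / Real.log δ + 3 * N, ?_, fun φ => ?_⟩
  · have : 0 ≤ Real.log C / Real.log δ := by positivity
    linarith
  · obtain ⟨h1, h2⟩ := lamA_gap hN φ
    have h1' := (lamA_gap hN φ⁻¹).1
    have h0 := Real.log_nonneg h1
    rcases h2 with h2 | h2
    · have h3 := lamA_inv_le_one_of_isHalfTreeLike hN h2
      rw [le_antisymm h3 h1', Real.log_one]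
      positivity
    · have h3 := Real.log_le_log (by linarith) (hpow φ)
      rw [Real.log_mul (by positivity) (by positivity), Real.log_pow] at h3
      have h4 : Real.log δ ≤ Real.log (lamA N (fun w => φ w)) :=
        Real.log_le_log (by linarith) h2
      have h5 : Real.log C ≤ Real.log C / Real.log δ * Real.log (lamA N (fun w => φ w)) := by
        calc Real.log C = Real.log C / Real.log δ * Real.log δ := by field_simp
          _ ≤ _ := by gcongr
      push_cast at h3
      linarith

end GenericStretch

/-- for every `N ≥ 2` there exists `D = D(N) ≥ 1` so that for every
automorphism `φ` of `F_N`: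
`(1/D)·log λ_A(φ) ≤ log λ_A(φ⁻¹) ≤ D·log λ_A(φ)`. -/
theorem stmt9 (N : ℕ) (hN : 2 ≤ N) :
    ∃ D : ℝ, 1 ≤ D ∧ ∀ φ : MulAut (FreeGroup (Fin N)),
      (1 / D) * Real.log (lamA N (fun w => φ w)) ≤ Real.log (lamA N (fun w => φ⁻¹ w)) ∧
      Real.log (lamA N (fun w => φ⁻¹ w)) ≤ D * Real.log (lamA N (fun w => φ w)) := by
  obtain ⟨D, hD, h⟩ := GenericStretch.exists_log_lamA_inv_le hN
  refine ⟨D, hD, fun φ => ⟨?_, h φ⟩⟩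
  have h1 := h φ⁻¹
  rw [inv_inv] at h1
  rw [one_div, inv_mul_le_iff₀ (by linarith)]
  exact h1
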